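/- Let χ be a tame symplectomorphism of ℝ^{2n}, g∈𝒮(ℝⁿ), α,β>0 and Λ=αℤⁿ×βℤⁿ such that 𝒢(g,Λ)={𝒯̂(z)g : z∈Λ} is a frame for L²(ℝⁿ), s≥0, and for each ħ∈(0,1] let A^ħ:𝒮(ℝⁿ)→𝒮′(ℝⁿ) be a continuous linear operator; set h=2πħ. Then the following are equivalent: (i) there exists C>0 such that for all ħ∈(0,1] and all z,w∈ℝ^{2n}, |⟨A^ħ𝒯̂^ħ(z)g^h, 𝒯̂^ħ(w)g^h⟩| ≤ C(1+|h^{−1/2}(w−χ(z))|²)^{−s/2}; (ii) there exists C′>0 such that for all ħ∈(0,1] and all λ,μ in the lattice h^{1/2}Λ, |⟨A^ħ𝒯̂^ħ(λ)g^h, 𝒯̂^ħ(μ)g^h⟩| ≤ C′(1+|h^{−1/2}(μ−χ(λ))|²)^{−s/2}. -/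

import Mathlib

noncomputable section
open MeasureTheory Filter Complex Real
open scoped ComplexConjugate BigOperators NNReal ENNReal

namespace SC

variable {n : ℕ}

abbrev Rn (n : ℕ) := Fin n → ℝ
abbrev Ph (n : ℕ) := (Fin n → ℝ) × (Fin n → ℝ)

/-- Euclidean dot product on ℝⁿ. -/
def dot (x y : Rn n) : ℝ := ∑ i, x i * y i

/-- squared Euclidean norm on ℝⁿ. -/
def sq (x : Rn n) : ℝ := ∑ i, x i ^ 2

/-- squared Euclidean norm on phase space ℝ^{2n}. -/
def sq2 (z : Ph n) : ℝ := sq z.1 + sq z.2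

/-- translation operator T_x. -/
def Tr (x : Rn n) (f : Rn n → ℂ) : Rn n → ℂ := fun t => f (t - x)

/-- modulation operator M_ξ. -/
def Mo (ξ : Rn n) (f : Rn n → ℂ) : Rn n → ℂ :=
  fun t => Complex.exp (2 * (Real.pi : ℂ) * Complex.I * ((dot ξ t : ℝ) : ℂ)) * f t

/-- dilation operator D_λ. -/
def Dil (lam : ℝ) (f : Rn n → ℂ) : Rn n → ℂ :=
  fun x => ((lam ^ ((n : ℝ) / 2) : ℝ) : ℂ) * f (lam • x)

/-- Weyl–Heisenberg operator 𝒯̂^ħ(z). -/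
def WH (hbar : ℝ) (z : Ph n) (f : Rn n → ℂ) : Rn n → ℂ :=
  fun x => Complex.exp (Complex.I * ((hbar⁻¹ * (dot z.2 x - dot z.1 z.2 / 2) : ℝ) : ℂ)) * f (x - z.1)

/-- 𝒯̂ = 𝒯̂^{1/(2π)}. -/
def T1 (z : Ph n) (f : Rn n → ℂ) : Rn n → ℂ := WH (1 / (2 * Real.pi)) z f

/-- L² inner product ⟨f,g⟩ = ∫ f ⋅ conj g. -/
def l2inner (f g : Rn n → ℂ) : ℂ := ∫ t, f t * conj (g t)

/-- ‖f‖₂². -/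
def l2normSq (f : Rn n → ℂ) : ℝ := ∫ t, ‖f t‖ ^ 2

/-- rescaled window g^h = D_{h^{-1/2}} g. -/
def gh (h : ℝ) (g : Rn n → ℂ) : Rn n → ℂ := Dil (Real.sqrt h)⁻¹ g

/-- coercion of integer lattice point. -/
def iC (k : Fin n → ℤ) : Rn n := fun i => (k i : ℝ)

/-- A and B are frame bounds for the system of atoms. -/
def FrameBounds {ι : Type} (A B : ℝ) (atom : ι → Rn n → ℂ) : Prop :=
  ∀ f : Rn n → ℂ, MemLp f 2 volume →
    ENNReal.ofReal (A * l2normSq f) ≤ ∑' i, (‖l2inner f (atom i)‖₊ : ℝ≥0∞) ^ 2 ∧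
    ∑' i, (‖l2inner f (atom i)‖₊ : ℝ≥0∞) ^ 2 ≤ ENNReal.ofReal (B * l2normSq f)

/-- the system of atoms is a frame for L²(ℝⁿ). -/
def IsFrame {ι : Type} (atom : ι → Rn n → ℂ) : Prop :=
  ∃ A B : ℝ, 0 < A ∧ A ≤ B ∧ FrameBounds A B atom

/-- Gabor atoms T_{αk} M_{βm} g, indexed by (k,m) ∈ ℤⁿ×ℤⁿ. -/
def gaborAtom (α β : ℝ) (g : Rn n → ℂ) (km : (Fin n → ℤ) × (Fin n → ℤ)) : Rn n → ℂ :=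
  Tr (α • iC km.1) (Mo (β • iC km.2) g)

/-- the standard Gaussian ψ₀. -/
def ψ₀ : Rn n → ℂ :=
  fun x => (((2 : ℝ) ^ ((n : ℝ) / 4) : ℝ) : ℂ) * Complex.exp ((-(Real.pi * sq x) : ℝ) : ℂ)




/-- tempered distributions, modeled as continuous linear functionals on the Schwartz space;
the (antilinear) pairing ⟨u,φ⟩ of the paper is `u` applied to (a Schwartz representative of)
the complex conjugate of φ. -/
abbrev Distrib (n : ℕ) := SchwartzMap (Rn n) ℂ →L[ℂ] ℂ

/-- L^p "norm" (with exponent in ℝ≥0∞, 1 ≤ p ≤ ∞) of an ℝ≥0∞-valued function. -/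
def eLpNormR {α : Type*} [MeasurableSpace α] (p : ℝ≥0∞) (μ : Measure α)
    (F : α → ℝ≥0∞) : ℝ≥0∞ :=
  if p = ∞ then essSup F μ else (∫⁻ a, F a ^ p.toReal ∂μ) ^ (1 / p.toReal)

/-- mixed L^{p,q} norm over phase space (L^p in x, then L^q in ξ). -/
def mixedNorm (p q : ℝ≥0∞) (F : Ph n → ℝ≥0∞) : ℝ≥0∞ :=
  eLpNormR q volume (fun ξ : Rn n => eLpNormR p volume (fun x : Rn n => F (x, ξ)))

/-- v is a continuous, positive, even, submultiplicative weight. -/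
def Submult (v : Ph n → ℝ) : Prop :=
  Continuous v ∧ (∀ z, 0 < v z) ∧ (∀ z, v (-z) = v z) ∧ v 0 = 1 ∧
    ∀ z w, v (z + w) ≤ v z * v w

/-- m is a continuous, positive, even, v-moderate weight. -/
def Moderate (v m : Ph n → ℝ) : Prop :=
  Continuous m ∧ (∀ z, 0 < m z) ∧ (∀ z, m (-z) = m z) ∧
    ∃ C : ℝ, 0 < C ∧ ∀ z w, m (z + w) ≤ C * v z * m w
/-- the point of the lattice Λ = αℤⁿ×βℤⁿ indexed by (j,l) ∈ ℤⁿ×ℤⁿ. -/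
def latt (α β : ℝ) (k : (Fin n → ℤ) × (Fin n → ℤ)) : Ph n := (α • iC k.1, β • iC k.2)

/-- the standard symplectic form on ℝ^{2n}. -/
def symp (z w : Ph n) : ℝ := dot z.2 w.1 - dot z.1 w.2

/-- χ is a tame symplectomorphism: a smooth bijection with smooth inverse, preserving the
standard symplectic form, with all derivatives of order ≥ 1 bounded on ℝ^{2n}. -/
def IsTameSymplecto (χ : Ph n → Ph n) : Prop :=
  ContDiff ℝ ((⊤ : ℕ∞) : WithTop ℕ∞) χ ∧
  (∃ χi : Ph n → Ph n, Function.LeftInverse χi χ ∧ Function.RightInverse χi χ ∧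
      ContDiff ℝ ((⊤ : ℕ∞) : WithTop ℕ∞) χi) ∧
  (∀ z u w : Ph n, symp (fderiv ℝ χ z u) (fderiv ℝ χ z w) = symp u w) ∧
  (∀ k : ℕ, 1 ≤ k → ∃ C : ℝ, ∀ z, ‖iteratedFDeriv ℝ k χ z‖ ≤ C)

/-! ### Part 1: abstract localisation of frame coefficients -/

abbrev L2 (ι : Type) : Type := ↥(lp (fun _ : ι => ℂ) 2)

lemma l2_summable {ι : Type} (b : L2 ι) : Summable fun i => ‖b i‖ ^ 2 := by
  have := (memℓp_gen_iff (p := 2) (by norm_num)).1 (lp.memℓp b)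
  simpa using this

lemma l2_norm_sq {ι : Type} (b : L2 ι) : ‖b‖ ^ 2 = ∑' i, ‖b i‖ ^ 2 := by
  have := lp.norm_rpow_eq_tsum (p := 2) (by norm_num) b
  simpa using this

lemma l2_mem {ι : Type} {b : ι → ℂ} (h : Summable fun i => ‖b i‖ ^ 2) :
    Memℓp b 2 := by
  refine (memℓp_gen_iff (p := 2) (by norm_num)).2 ?_
  simpa using h

lemma l2_apply_le {ι : Type} (b : L2 ι) (i : ι) : ‖b i‖ ≤ ‖b‖ :=
  lp.norm_apply_le_norm (by norm_num) b i

lemma l2_norm_le {ι : Type} (b : L2 ι) {K : ℝ} (hK : 0 ≤ K) (h : ∑' i, ‖b i‖ ^ 2 ≤ K ^ 2) :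
    ‖b‖ ≤ K := by
  rw [← l2_norm_sq] at h
  exact le_of_sq_le_sq h hK

lemma exists_mshift {ι : Type} (σ : ι ≃ ι) (m : ι → ℂ) (K : ℝ) (hK : 0 ≤ K)
    (hm : ∀ i, ‖m i‖ ≤ K) :
    ∃ T : L2 ι →L[ℂ] L2 ι, ‖T‖ ≤ K ∧ ∀ b i, T b i = m i * b (σ i) := by
  have hle : ∀ (b : L2 ι) i, ‖m i * b (σ i)‖ ^ 2 ≤ K ^ 2 * ‖b (σ i)‖ ^ 2 := by
    intro b i
    rw [norm_mul, mul_pow]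
    gcongr
    exact hm i
  have hs : ∀ b : L2 ι, Summable fun i => K ^ 2 * ‖b (σ i)‖ ^ 2 := by
    intro b
    exact ((σ.summable_iff (f := fun i => ‖b i‖ ^ 2)).2 (l2_summable b)).mul_left _
  have hmem : ∀ b : L2 ι, Memℓp (fun i => m i * b (σ i)) 2 := fun b =>
    l2_mem (Summable.of_nonneg_of_le (fun i => by positivity) (hle b) (hs b))
  let T0 : L2 ι →ₗ[ℂ] L2 ι :=
    { toFun := fun b => ⟨fun i => m i * b (σ i), hmem b⟩
      map_add' := by
        intro x y
        ext i
        exact mul_add _ _ _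
      map_smul' := by
        intro c x
        ext i
        simp [mul_left_comm] }
  have hb : ∀ b, ‖T0 b‖ ≤ K * ‖b‖ := by
    intro b
    refine l2_norm_le _ (by positivity) ?_
    calc ∑' i, ‖T0 b i‖ ^ 2 ≤ ∑' i, K ^ 2 * ‖b (σ i)‖ ^ 2 :=
          Summable.tsum_le_tsum (hle b) (l2_summable (T0 b)) (hs b)
      _ = K ^ 2 * ∑' i, ‖b i‖ ^ 2 := by
          rw [tsum_mul_left, σ.tsum_eq (fun i => ‖b i‖ ^ 2)]
      _ = (K * ‖b‖) ^ 2 := by rw [← l2_norm_sq, mul_pow]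
  exact ⟨T0.mkContinuous K hb, T0.mkContinuous_norm_le hK hb, fun b i => rfl⟩

lemma exists_schur {ι : Type} [AddCommGroup ι] (M : ι → ι → ℂ) (k : ι → ℝ) (hk : Summable k)
    (hM : ∀ i j, ‖M i j‖ ≤ k (i - j)) :
    ∃ E : L2 ι →L[ℂ] L2 ι, ‖E‖ ≤ ∑' ν, k ν ∧
      ∀ b i, HasSum (fun j => M i j * b j) (E b i) := by
  have hk0 : ∀ ν, 0 ≤ k ν := fun ν => by
    have := hM ν 0
    rw [sub_zero] at this
    exact (norm_nonneg _).trans this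
  have := fun ν : ι => exists_mshift (Equiv.subRight ν) (fun i => M i (i - ν)) (k ν) (hk0 ν)
    (fun i => by simpa using hM i (i - ν))
  choose T hT hTa using this
  have hsum : Summable T := Summable.of_norm_bounded hk hT
  refine ⟨∑' ν, T ν, tsum_of_norm_bounded hk.hasSum hT, fun b i => ?_⟩
  have h1 : HasSum (fun ν => T ν b i) ((∑' ν, T ν) b i) := by
    have h2 := hsum.hasSum
    have h3 := (ContinuousLinearMap.apply ℂ (L2 ι) b).hasSum h2
    exact (lp.evalCLM ℂ (fun _ : ι => ℂ) 2 i).hasSum h3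
  have h4 := (Equiv.subLeft i).hasSum_iff.2 h1
  convert h4 using 2 with j
  simp [hTa]

section frame
variable {ι H : Type} [NormedAddCommGroup H] [InnerProductSpace ℂ H] [CompleteSpace H]

lemma exists_analysis (e : ι → H) (B : ℝ) (hB : 0 ≤ B)
    (hs : ∀ f : H, Summable fun i => ‖inner ℂ (e i) f‖ ^ 2)
    (hu : ∀ f : H, ∑' i, ‖inner ℂ (e i) f‖ ^ 2 ≤ B * ‖f‖ ^ 2) :
    ∃ C : H →L[ℂ] L2 ι, ∀ f i, C f i = inner ℂ (e i) f := by
  let T0 : H →ₗ[ℂ] L2 ι :=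
    { toFun := fun f => ⟨fun i => inner ℂ (e i) f, l2_mem (hs f)⟩
      map_add' := by
        intro x y
        ext i
        exact inner_add_right _ _ _
      map_smul' := by
        intro c x
        ext i
        exact inner_smul_right _ _ _ }
  have hb : ∀ f, ‖T0 f‖ ≤ √B * ‖f‖ := by
    intro f
    refine l2_norm_le _ (by positivity) ?_
    rw [mul_pow, Real.sq_sqrt hB]
    exact hu f
  exact ⟨T0.mkContinuous _ hb, fun f i => rfl⟩

/-- the relaxed operator `1 - B⁻¹ C C*`. -/
def relT (C : H →L[ℂ] L2 ι) (B : ℝ) : L2 ι →L[ℂ] L2 ι :=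
  1 - ((B⁻¹ : ℝ) : ℂ) • (C ∘L ContinuousLinearMap.adjoint C)

lemma relT_apply (C : H →L[ℂ] L2 ι) (B : ℝ) (c : L2 ι) :
    relT C B c = c - ((B⁻¹ : ℝ) : ℂ) • C (ContinuousLinearMap.adjoint C c) := by
  simp [relT]

lemma relT_norm_sq (C : H →L[ℂ] L2 ι) (B : ℝ) (hB : 0 < B)
    (hu : ∀ f : H, ‖C f‖ ^ 2 ≤ B * ‖f‖ ^ 2) (c : L2 ι) :
    ‖relT C B c‖ ^ 2 ≤ ‖c‖ ^ 2 - B⁻¹ * ‖ContinuousLinearMap.adjoint C c‖ ^ 2 := by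
  rw [relT_apply, @norm_sub_sq ℂ, inner_smul_right, ← ContinuousLinearMap.adjoint_inner_left,
    inner_self_eq_norm_sq_to_K, norm_smul, mul_pow]
  have h1 := hu (ContinuousLinearMap.adjoint C c)
  have h2 : RCLike.re (((B⁻¹ : ℝ) : ℂ) * ((‖ContinuousLinearMap.adjoint C c‖ : ℝ) : ℂ) ^ 2)
      = B⁻¹ * ‖ContinuousLinearMap.adjoint C c‖ ^ 2 := by
    rw [← Complex.ofReal_pow, ← Complex.ofReal_mul]
    exact Complex.ofReal_re _
  have h3 : ‖((B⁻¹ : ℝ) : ℂ)‖ = B⁻¹ := by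
    rw [Complex.norm_real, Real.norm_of_nonneg (by positivity)]
  erw [h2]
  rw [h3]
  have h4 : B⁻¹ ^ 2 * ‖C (ContinuousLinearMap.adjoint C c)‖ ^ 2 ≤
      B⁻¹ ^ 2 * (B * ‖ContinuousLinearMap.adjoint C c‖ ^ 2) := by gcongr
  have h5 : B⁻¹ ^ 2 * (B * ‖ContinuousLinearMap.adjoint C c‖ ^ 2) =
    B⁻¹ * ‖ContinuousLinearMap.adjoint C c‖ ^ 2 := by field_simp
  linarith

lemma relT_norm_le (C : H →L[ℂ] L2 ι) (B : ℝ) (hB : 0 < B)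
    (hu : ∀ f : H, ‖C f‖ ^ 2 ≤ B * ‖f‖ ^ 2) : ‖relT C B‖ ≤ 1 := by
  refine ContinuousLinearMap.opNorm_le_bound _ zero_le_one fun c => ?_
  rw [one_mul]
  refine le_of_sq_le_sq ?_ (norm_nonneg _)
  have := relT_norm_sq C B hB hu c
  have h2 : 0 ≤ B⁻¹ * ‖ContinuousLinearMap.adjoint C c‖ ^ 2 := by positivity
  linarith

lemma relT_range (C : H →L[ℂ] L2 ι) (A B : ℝ) (hA : 0 < A) (hB : 0 < B)
    (hl : ∀ f : H, A * ‖f‖ ^ 2 ≤ ‖C f‖ ^ 2)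
    (hu : ∀ f : H, ‖C f‖ ^ 2 ≤ B * ‖f‖ ^ 2) (f : H) :
    ‖relT C B (C f)‖ ^ 2 ≤ (1 - A / B) * ‖C f‖ ^ 2 := by
  have h1 := relT_norm_sq C B hB hu (C f)
  set S := ContinuousLinearMap.adjoint C (C f) with hS
  have h2 : ‖C f‖ ^ 2 ≤ ‖S‖ * ‖f‖ := by
    have : inner ℂ S f = ((‖C f‖ : ℝ) : ℂ) ^ 2 := by
      rw [hS, ContinuousLinearMap.adjoint_inner_left, inner_self_eq_norm_sq_to_K]
      rfl
    have h3 := norm_inner_le_norm (𝕜 := ℂ) S f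
    rw [this, norm_pow, Complex.norm_real, norm_norm] at h3
    exact h3
  have h3 : A * ‖C f‖ ^ 2 ≤ ‖S‖ ^ 2 := by
    rcases (norm_nonneg f).eq_or_lt with h0 | h0
    · have : ‖C f‖ ^ 2 ≤ 0 := by rw [← h0] at h2; simpa using h2
      nlinarith [sq_nonneg ‖S‖]
    · have h4 : A * ‖f‖ ≤ ‖S‖ := by
        have := (hl f).trans h2
        by_contra hc
        push Not at hc
        nlinarith
      nlinarith [norm_nonneg S]
  have h4 : A / B * ‖C f‖ ^ 2 ≤ B⁻¹ * ‖S‖ ^ 2 := by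
    rw [div_eq_inv_mul, mul_assoc]
    gcongr
  linarith

lemma relT_pow_range (C : H →L[ℂ] L2 ι) (A B q : ℝ) (hA : 0 < A) (hB : 0 < B)
    (hl : ∀ f : H, A * ‖f‖ ^ 2 ≤ ‖C f‖ ^ 2) (hq : 0 ≤ q) (hqq : 1 - A / B ≤ q ^ 2)
    (hu : ∀ f : H, ‖C f‖ ^ 2 ≤ B * ‖f‖ ^ 2) (k : ℕ) : ∀ f : H,
    ‖(relT C B ^ k) (C f)‖ ≤ q ^ k * ‖C f‖ := by
  induction k with
  | zero => intro f; simp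
  | succ k ih =>
    intro f
    have h1 : relT C B (C f) = C (f - ((B⁻¹ : ℝ) : ℂ) • ContinuousLinearMap.adjoint C (C f)) := by
      rw [relT_apply, map_sub, map_smul]
    have h2 : ‖relT C B (C f)‖ ≤ q * ‖C f‖ := by
      refine le_of_sq_le_sq ?_ (by positivity)
      refine (relT_range C A B hA hB hl hu f).trans ?_
      rw [mul_pow]
      gcongr
    have h3 := ih (f - ((B⁻¹ : ℝ) : ℂ) • ContinuousLinearMap.adjoint C (C f))
    rw [← h1] at h3
    rw [pow_succ, mul_apply_eq_comp]
    calc _ ≤ _ := h3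
      _ ≤ q ^ k * (q * ‖C f‖) := by gcongr
      _ = _ := by ring

lemma adjoint_single [DecidableEq ι] (e : ι → H) (C : H →L[ℂ] L2 ι)
    (hC : ∀ f i, C f i = inner ℂ (e i) f)
    (i : ι) (a : ℂ) : ContinuousLinearMap.adjoint C (lp.single 2 i a) = a • e i := by
  refine ext_inner_right ℂ fun f => ?_
  rw [ContinuousLinearMap.adjoint_inner_left, lp.inner_single_left, hC, inner_smul_left]
  simp [mul_comm]

lemma adjoint_hasSum (e : ι → H) (C : H →L[ℂ] L2 ι)
    (hC : ∀ f i, C f i = inner ℂ (e i) f) (c : L2 ι) :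
    HasSum (fun i => c i • e i) (ContinuousLinearMap.adjoint C c) := by
  classical
  have h1 := (ContinuousLinearMap.adjoint C).hasSum (lp.hasSum_single (p := 2) (by norm_num) c)
  convert h1 using 2 with i
  rw [adjoint_single e C hC]

lemma gram_hasSum (e : ι → H) (C : H →L[ℂ] L2 ι)
    (hC : ∀ f i, C f i = inner ℂ (e i) f) (c : L2 ι) (i : ι) :
    HasSum (fun j => inner ℂ (e i) (e j) * c j) (C (ContinuousLinearMap.adjoint C c) i) := by
  have h1 := (innerSL ℂ (e i)).hasSum (adjoint_hasSum e C hC c)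
  rw [hC]
  have h2 : (fun j => inner ℂ (e i) (e j) * c j) = fun j => (innerSL ℂ (e i)) (c j • e j) := by
    funext j
    rw [innerSL_apply_apply, inner_smul_right, mul_comm]
  rw [h2]
  exact h1

lemma clm_pow_le [NormedSpace ℂ H] (S : H →L[ℂ] H) {r : ℝ} (hr : 0 ≤ r) (hS : ‖S‖ ≤ r) (k : ℕ) :
    ∀ b, ‖(S ^ k) b‖ ≤ r ^ k * ‖b‖ := by
  induction k with
  | zero => intro b; simp
  | succ k ih =>
    intro b
    rw [pow_succ, mul_apply_eq_comp]
    refine (ih _).trans ?_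
    rw [pow_succ, mul_assoc]
    gcongr
    exact (S.le_opNorm b).trans (by gcongr)

lemma weight_inv_le {ε x : ℝ} (N : ℕ) (hε0 : 0 < ε) (hε1 : ε ≤ 1) (hx : 0 ≤ x) :
    ((1 + ε * x) ^ (2 * N))⁻¹ ≤ ((ε ^ N)⁻¹ * ((1 + x) ^ N)⁻¹) ^ 2 := by
  rw [← mul_inv, ← mul_pow, inv_pow, ← pow_mul, mul_comm N 2]
  gcongr
  nlinarith

lemma ratio_pow_sub_one {a b d ε : ℝ} (N : ℕ) (ha : 0 ≤ a) (hb : 0 ≤ b) (hd : 0 ≤ d)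
    (hε : 0 ≤ ε) (hε1 : ε ≤ 1) (hab : |a - b| ≤ d) :
    |(1 + ε * a) ^ N / (1 + ε * b) ^ N - 1| ≤ ε * N * (1 + d) ^ N := by
  have hb1 : 1 ≤ 1 + ε * b := by nlinarith [mul_nonneg hε hb]
  set r := (1 + ε * a) / (1 + ε * b) with hr
  have hr0 : 0 ≤ r := by positivity
  have hr1 : |r - 1| ≤ ε * d := by
    have : r - 1 = ε * (a - b) / (1 + ε * b) := by
      rw [hr]; field_simp; ring
    rw [this, abs_div, abs_mul, abs_of_nonneg hε, abs_of_pos (by linarith : 0 < 1 + ε * b)]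
    rw [div_le_iff₀ (by linarith)]
    have : ε * |a - b| ≤ ε * d := by gcongr
    nlinarith [mul_nonneg hε hd]
  have hr2 : r ≤ 1 + d := by
    have := (abs_le.1 hr1).2
    nlinarith
  rw [← div_pow, ← hr]
  have h1 : ∀ m : ℕ, |r ^ m - 1| ≤ ε * m * (1 + d) ^ m := by
    intro m
    induction m with
    | zero => simp
    | succ m ih =>
      have h2 : r ^ (m + 1) - 1 = r * (r ^ m - 1) + (r - 1) := by ring
      rw [h2]
      have h3 : (1 : ℝ) ≤ (1 + d) ^ m := one_le_pow₀ (by linarith)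
      calc |r * (r ^ m - 1) + (r - 1)| ≤ |r * (r ^ m - 1)| + |r - 1| := abs_add_le _ _
        _ = r * |r ^ m - 1| + |r - 1| := by rw [abs_mul, abs_of_nonneg hr0]
        _ ≤ (1 + d) * (ε * m * (1 + d) ^ m) + ε * d := by gcongr
        _ ≤ (1 + d) * (ε * m * (1 + d) ^ m) + ε * (1 + d) ^ (m + 1) := by
            gcongr
            rw [pow_succ]
            nlinarith
        _ = _ := by push_cast; ring
  exact h1 N

set_option maxHeartbeats 1000000 in
lemma coeff_decay {U : Type} [AddCommGroup ι] (e : ι → H) (C : H →L[ℂ] L2 ι) (A B : ℝ)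
    (hA : 0 < A) (hAB : A ≤ B)
    (hC : ∀ f i, C f i = inner ℂ (e i) f)
    (hl : ∀ f : H, A * ‖f‖ ^ 2 ≤ ‖C f‖ ^ 2)
    (hu : ∀ f : H, ‖C f‖ ^ 2 ≤ B * ‖f‖ ^ 2)
    (p : U → ι → ℝ) (ℓ : ι → ℝ) (hp0 : ∀ u i, 0 ≤ p u i) (hℓ0 : ∀ i, 0 ≤ ℓ i)
    (hp : ∀ u i j, |p u i - p u j| ≤ ℓ (i - j)) (M0 : ℕ)
    (hsum : Summable fun ν => ((1 + ℓ ν) ^ M0)⁻¹) (K : ℝ)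
    (hK : ∀ u, Summable (fun i => ((1 + p u i) ^ M0)⁻¹) ∧ ∑' i, ((1 + p u i) ^ M0)⁻¹ ≤ K)
    (hG : ∀ N : ℕ, ∃ c, 0 ≤ c ∧ ∀ i j, ‖inner ℂ (e i) (e j)‖ ≤ c * ((1 + ℓ (i - j)) ^ N)⁻¹)
    (f : U → H)
    (hf : ∀ N : ℕ, ∃ c, 0 ≤ c ∧ ∀ u i, ‖inner ℂ (e i) (f u)‖ ≤ c * ((1 + p u i) ^ N)⁻¹)
    (N : ℕ) :
    ∃ c θ : ℝ, 0 ≤ c ∧ 0 ≤ θ ∧ θ < 1 ∧ ∀ u (k : ℕ) i,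
      ‖((relT C B ^ k) (C (f u))) i‖ ≤ c * θ ^ k * ((1 + p u i) ^ N)⁻¹ := by
  have hB : 0 < B := hA.trans_le hAB
  obtain ⟨cG, hcG, hG⟩ := hG (2 * N + M0)
  obtain ⟨cf, hcf, hf⟩ := hf (2 * N + M0)
  set q := √(1 - A / B) with hqdef
  have hAB1 : A / B ≤ 1 := (div_le_one hB).2 hAB
  have hq0 : 0 ≤ q := Real.sqrt_nonneg _
  have hqq : q ^ 2 = 1 - A / B := Real.sq_sqrt (by linarith)
  have hq1 : q < 1 := by
    have : 0 < A / B := by positivity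
    nlinarith
  set η := (1 - q) / 2 with hη
  have hη0 : 0 < η := by rw [hη]; linarith
  have hqη : q * (1 + η) < 1 := by rw [hη]; nlinarith
  set Sg := ∑' ν, ((1 + ℓ ν) ^ M0)⁻¹ with hSg
  have hSg0 : 0 ≤ Sg := tsum_nonneg fun ν => by have := hℓ0 ν; positivity
  set K1 := B⁻¹ * cG * (2 * N : ℕ) * Sg with hK1
  have hK10 : 0 ≤ K1 := by positivity
  set ε := min 1 (η / (K1 + 1)) with hε
  have hε0 : 0 < ε := lt_min one_pos (by positivity)
  have hε1 : ε ≤ 1 := min_le_left _ _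
  have hεK : ε * K1 ≤ η := by
    calc ε * K1 ≤ η / (K1 + 1) * (K1 + 1) := by
          gcongr
          · exact min_le_right _ _
          · linarith
      _ = η := by field_simp
  set R := cf * √K with hR
  have hR0 : 0 ≤ R := by positivity
  refine ⟨R * (ε ^ N)⁻¹, √(q * (1 + η)), by positivity, Real.sqrt_nonneg _, ?_, ?_⟩
  · rw [Real.sqrt_lt' one_pos]; simpa using hqη
  intro u
  set v : ι → ℝ := fun i => (1 + ε * p u i) ^ (2 * N) with hv
  have hv1 : ∀ i, 1 ≤ v i := fun i => one_le_pow₀ (by nlinarith [mul_nonneg hε0.le (hp0 u i)])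
  have hv0 : ∀ i, 0 < v i := fun i => one_pos.trans_le (hv1 i)
  obtain ⟨D, hD1, hD⟩ := exists_mshift (Equiv.refl ι) (fun i => (((v i)⁻¹ : ℝ) : ℂ)) 1 zero_le_one
    (fun i => by
      rw [Complex.norm_real, Real.norm_of_nonneg (by have := hv0 i; positivity)]
      exact inv_le_one_of_one_le₀ (hv1 i))
  obtain ⟨E, hE1, hE⟩ := exists_schur
    (fun i j => -((B⁻¹ : ℝ) : ℂ) * (inner ℂ (e i) (e j)) * ((v i / v j - 1 : ℝ) : ℂ))
    (fun ν => B⁻¹ * cG * (2 * N : ℕ) * ε * ((1 + ℓ ν) ^ M0)⁻¹) (hsum.mul_left _) (by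
      intro i j
      rw [norm_mul, norm_mul, norm_neg, Complex.norm_real, Complex.norm_real,
        Real.norm_of_nonneg (by positivity : 0 ≤ B⁻¹), Real.norm_eq_abs]
      have h1 := ratio_pow_sub_one (2 * N) (hp0 u i) (hp0 u j) (hℓ0 (i - j)) hε0.le hε1 (hp u i j)
      have h2 := hG i j
      have h3 : 0 < 1 + ℓ (i - j) := by have := hℓ0 (i - j); linarith
      calc _ ≤ B⁻¹ * (cG * ((1 + ℓ (i - j)) ^ (2 * N + M0))⁻¹) *
            (ε * (2 * N : ℕ) * (1 + ℓ (i - j)) ^ (2 * N)) := by gcongr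
        _ = _ := by rw [pow_add]; field_simp)
  have hE2 : ‖E‖ ≤ η := by
    refine hE1.trans ?_
    rw [tsum_mul_left]
    calc _ = ε * K1 := by rw [hK1]; ring
      _ ≤ η := hεK
  set T := relT C B with hT
  have hT1 : ‖T‖ ≤ 1 := relT_norm_le C B hB hu
  have hTE : ‖T + E‖ ≤ 1 + η := (norm_add_le _ _).trans (add_le_add hT1 hE2)
  have hcomm : ∀ b, T (D b) = D ((T + E) b) := by
    intro b
    ext i
    have h1 := gram_hasSum e C hC (D b) i
    have h2 := gram_hasSum e C hC b i
    have h3 := hE b i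
    have h4 : HasSum (fun j => -((B⁻¹ : ℝ) : ℂ) * (inner ℂ (e i) (e j) * (D b) j))
      (-((B⁻¹ : ℝ) : ℂ) * (C (ContinuousLinearMap.adjoint C (D b)) i)) := h1.mul_left _
    have h5 : HasSum (fun j => -((B⁻¹ : ℝ) : ℂ) * (inner ℂ (e i) (e j) * (D b) j))
      ((((v i)⁻¹ : ℝ) : ℂ) * (-((B⁻¹ : ℝ) : ℂ) * (C (ContinuousLinearMap.adjoint C b) i) +
        E b i)) := by
      have h7 := ((h2.mul_left (-((B⁻¹ : ℝ) : ℂ))).add h3).mul_left ((((v i)⁻¹ : ℝ) : ℂ))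
      refine (congrArg (fun F => HasSum F _) ?_).mpr h7
      funext j
      rw [hD]
      have hvi : ((v i : ℝ) : ℂ) ≠ 0 := by exact_mod_cast (hv0 i).ne'
      have hvj : ((v j : ℝ) : ℂ) ≠ 0 := by exact_mod_cast (hv0 j).ne'
      push_cast
      simp only [Equiv.refl_apply]
      field_simp
      ring
    have h6 := h4.unique h5
    rw [hD, hT, relT_apply]
    simp only [add_apply, relT_apply, lp.coeFn_sub, lp.coeFn_smul,
      lp.coeFn_add, Pi.sub_apply, Pi.add_apply, Pi.smul_apply, smul_eq_mul, Equiv.refl_apply]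
    rw [hD]
    simp only [Equiv.refl_apply]
    linear_combination h6
  have hpow : ∀ k : ℕ, ∀ b, (T ^ k) (D b) = D (((T + E) ^ k) b) := by
    intro k
    induction k with
    | zero => intro b; simp
    | succ k ih =>
      intro b
      rw [pow_succ, mul_apply_eq_comp, hcomm, ih, pow_succ, mul_apply_eq_comp]
  have hx : ∀ i, 0 < 1 + p u i := fun i => by have := hp0 u i; linarith
  have hbb : ∀ i, ‖((v i : ℝ) : ℂ) * inner ℂ (e i) (f u)‖ ^ 2 ≤ cf ^ 2 * ((1 + p u i) ^ M0)⁻¹ := by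
    intro i
    rw [norm_mul, Complex.norm_real, Real.norm_of_nonneg (hv0 i).le]
    have h1 : v i ≤ (1 + p u i) ^ (2 * N) := by
      have := hp0 u i
      simp only [hv]
      gcongr
      nlinarith
    have h2 : v i * ‖inner ℂ (e i) (f u)‖ ≤ cf * ((1 + p u i) ^ M0)⁻¹ := by
      have := hx i
      calc _ ≤ (1 + p u i) ^ (2 * N) * (cf * ((1 + p u i) ^ (2 * N + M0))⁻¹) := by
            gcongr
            exact hf u i
        _ = _ := by rw [pow_add]; field_simp
    have h3 : ((1 + p u i) ^ M0)⁻¹ ≤ 1 :=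
      inv_le_one_of_one_le₀ (one_le_pow₀ (by have := hp0 u i; linarith))
    have h4 : 0 ≤ ((1 + p u i) ^ M0)⁻¹ := by have := hx i; positivity
    calc _ ≤ (cf * ((1 + p u i) ^ M0)⁻¹) ^ 2 := by
          have := (hv0 i).le
          gcongr
      _ = cf ^ 2 * (((1 + p u i) ^ M0)⁻¹ * ((1 + p u i) ^ M0)⁻¹) := by ring
      _ ≤ cf ^ 2 * (((1 + p u i) ^ M0)⁻¹ * 1) := by gcongr
      _ = _ := by ring
  have hbs : Summable fun i => ‖((v i : ℝ) : ℂ) * inner ℂ (e i) (f u)‖ ^ 2 :=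
    Summable.of_nonneg_of_le (fun i => by positivity) hbb ((hK u).1.mul_left _)
  let b0 : L2 ι := ⟨fun i => ((v i : ℝ) : ℂ) * inner ℂ (e i) (f u), l2_mem hbs⟩
  have hb0 : ‖b0‖ ≤ R := by
    refine l2_norm_le _ hR0 ?_
    have hK0 : 0 ≤ K := le_trans (tsum_nonneg fun i => by have := hx i; positivity) (hK u).2
    calc _ ≤ ∑' i, cf ^ 2 * ((1 + p u i) ^ M0)⁻¹ :=
          Summable.tsum_le_tsum hbb hbs ((hK u).1.mul_left _)
      _ ≤ cf ^ 2 * K := by rw [tsum_mul_left]; gcongr; exact (hK u).2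
      _ = R ^ 2 := by rw [hR, mul_pow, Real.sq_sqrt hK0]
  have hDb : C (f u) = D b0 := by
    ext i
    rw [hD, hC]
    have hvi : ((v i : ℝ) : ℂ) ≠ 0 := by exact_mod_cast (hv0 i).ne'
    change _ = _ * (((v i : ℝ) : ℂ) * inner ℂ (e i) (f u))
    push_cast
    field_simp
  have hCf : ‖C (f u)‖ ≤ R := by
    rw [hDb]
    calc _ ≤ ‖D‖ * ‖b0‖ := D.le_opNorm _
      _ ≤ 1 * R := by gcongr
      _ = R := one_mul _
  intro k i
  have h1 : ‖((T ^ k) (C (f u))) i‖ ≤ q ^ k * R := by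
    refine (l2_apply_le _ i).trans ((relT_pow_range C A B q hA hB hl hq0 hqq.ge hu k (f u)).trans ?_)
    gcongr
  have h2 : ‖((T ^ k) (C (f u))) i‖ ≤ (v i)⁻¹ * ((1 + η) ^ k * R) := by
    rw [hDb, hpow, hD, norm_mul, Complex.norm_real,
      Real.norm_of_nonneg (by have := hv0 i; positivity)]
    have := hv0 i
    gcongr
    refine (l2_apply_le _ _).trans ?_
    refine (clm_pow_le (T + E) (by linarith) hTE k b0).trans ?_
    gcongr
  have h3 : (v i)⁻¹ ≤ ((ε ^ N)⁻¹ * ((1 + p u i) ^ N)⁻¹) ^ 2 :=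
    weight_inv_le N hε0 hε1 (hp0 u i)
  refine le_of_sq_le_sq ?_ (by have := hx i; positivity)
  calc ‖((T ^ k) (C (f u))) i‖ ^ 2 ≤ (q ^ k * R) * ((v i)⁻¹ * ((1 + η) ^ k * R)) := by
        rw [pow_two]; gcongr
    _ ≤ (q ^ k * R) * (((ε ^ N)⁻¹ * ((1 + p u i) ^ N)⁻¹) ^ 2 * ((1 + η) ^ k * R)) := by gcongr
    _ = (R * (ε ^ N)⁻¹ * ((1 + p u i) ^ N)⁻¹) ^ 2 * (q * (1 + η)) ^ k := by
        rw [mul_pow q (1 + η) k]; ring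
    _ = (R * (ε ^ N)⁻¹ * ((1 + p u i) ^ N)⁻¹) ^ 2 * (√(q * (1 + η)) ^ 2) ^ k := by
        rw [Real.sq_sqrt (by positivity)]
    _ = _ := by ring

theorem abstract_coeffs {U : Type} [AddCommGroup ι] (e : ι → H) (A B : ℝ)
    (hA : 0 < A) (hAB : A ≤ B)
    (hs : ∀ f : H, Summable fun i => ‖inner ℂ (e i) f‖ ^ 2)
    (hl : ∀ f : H, A * ‖f‖ ^ 2 ≤ ∑' i, ‖inner ℂ (e i) f‖ ^ 2)
    (hu : ∀ f : H, ∑' i, ‖inner ℂ (e i) f‖ ^ 2 ≤ B * ‖f‖ ^ 2)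
    (p : U → ι → ℝ) (ℓ : ι → ℝ) (hp0 : ∀ u i, 0 ≤ p u i) (hℓ0 : ∀ i, 0 ≤ ℓ i)
    (hp : ∀ u i j, |p u i - p u j| ≤ ℓ (i - j)) (M0 : ℕ)
    (hsum : Summable fun ν => ((1 + ℓ ν) ^ M0)⁻¹) (K : ℝ)
    (hK : ∀ u, Summable (fun i => ((1 + p u i) ^ M0)⁻¹) ∧ ∑' i, ((1 + p u i) ^ M0)⁻¹ ≤ K)
    (hG : ∀ N : ℕ, ∃ c, 0 ≤ c ∧ ∀ i j, ‖inner ℂ (e i) (e j)‖ ≤ c * ((1 + ℓ (i - j)) ^ N)⁻¹)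
    (f : U → H)
    (hf : ∀ N : ℕ, ∃ c, 0 ≤ c ∧ ∀ u i, ‖inner ℂ (e i) (f u)‖ ≤ c * ((1 + p u i) ^ N)⁻¹) :
    ∃ c : U → ι → ℂ,
      (∀ N : ℕ, ∃ a, 0 ≤ a ∧ ∀ u i, ‖c u i‖ ≤ a * ((1 + p u i) ^ N)⁻¹) ∧
      ∀ u, HasSum (fun i => c u i • e i) (f u) := by
  have hB : 0 < B := hA.trans_le hAB
  obtain ⟨C, hC⟩ := exists_analysis e B hB.le hs hu
  have hCn : ∀ f, ‖C f‖ ^ 2 = ∑' i, ‖inner ℂ (e i) f‖ ^ 2 := fun f => by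
    rw [l2_norm_sq]; simp only [hC]
  replace hl : ∀ f : H, A * ‖f‖ ^ 2 ≤ ‖C f‖ ^ 2 := fun f => by rw [hCn]; exact hl f
  replace hu : ∀ f : H, ‖C f‖ ^ 2 ≤ B * ‖f‖ ^ 2 := fun f => by rw [hCn]; exact hu f
  have hdec := coeff_decay e C A B hA hAB hC hl hu p ℓ hp0 hℓ0 hp M0 hsum K hK hG f hf
  set T := relT C B with hT
  have hq1 : √(1 - A / B) < 1 := by
    rw [Real.sqrt_lt' one_pos]
    have : 0 < A / B := by positivity
    linarith
  have hsm : ∀ u, Summable fun k : ℕ => (T ^ k) (C (f u)) := by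
    intro u
    have hAB1 : A / B ≤ 1 := (div_le_one hB).2 hAB
    refine Summable.of_norm_bounded
      ((summable_geometric_of_lt_one (Real.sqrt_nonneg _) hq1).mul_right ‖C (f u)‖) fun k => ?_
    exact relT_pow_range C A B _ hA hB hl (Real.sqrt_nonneg _)
      (Real.sq_sqrt (by linarith)).ge hu k (f u)
  set y : U → L2 ι := fun u => ∑' k : ℕ, (T ^ k) (C (f u)) with hy
  refine ⟨fun u i => (((B⁻¹ : ℝ) : ℂ) • y u : L2 ι) i, fun N => ?_, fun u => ?_⟩
  · obtain ⟨c, θ, hc, hθ, hθ1, hb⟩ := hdec N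
    refine ⟨B⁻¹ * (c * (1 - θ)⁻¹), ?_, fun u i => ?_⟩
    · have : 0 < 1 - θ := by linarith
      positivity
    have h1 : HasSum (fun k : ℕ => ((T ^ k) (C (f u))) i) (y u i) :=
      (lp.evalCLM ℂ (fun _ : ι => ℂ) 2 i).hasSum (hsm u).hasSum
    have h2 : ‖y u i‖ ≤ c * (1 - θ)⁻¹ * ((1 + p u i) ^ N)⁻¹ := by
      rw [← h1.tsum_eq]
      exact tsum_of_norm_bounded (((hasSum_geometric_of_lt_one hθ hθ1).mul_left c).mul_right _)
        (fun k => hb u k i)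
    change ‖((B⁻¹ : ℝ) : ℂ) * y u i‖ ≤ _
    rw [norm_mul, Complex.norm_real,
      Real.norm_of_nonneg (by positivity), mul_assoc B⁻¹]
    gcongr
  · have h1 : y u = C (f u) + T (y u) := by
      have h2 := (hsm u).tsum_eq_zero_add
      simp only [hy]
      rw [T.map_tsum (hsm u), h2]
      congr 1
      refine tsum_congr fun k => ?_
      rw [pow_succ', mul_apply_eq_comp]
    have h3 : ((B⁻¹ : ℝ) : ℂ) • C (ContinuousLinearMap.adjoint C (y u)) = C (f u) := by
      have h4 := relT_apply C B (y u)
      rw [← hT] at h4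
      rw [h4] at h1
      have := sub_eq_zero.2 h1
      rw [← sub_eq_zero, ← this]
      abel
    have h5 : ContinuousLinearMap.adjoint C (((B⁻¹ : ℝ) : ℂ) • y u) = f u := by
      rw [← sub_eq_zero]
      have h6 := hl (ContinuousLinearMap.adjoint C (((B⁻¹ : ℝ) : ℂ) • y u) - f u)
      rw [map_sub, map_smul, map_smul, h3, sub_self] at h6
      have h7 : ‖((B⁻¹ : ℝ) : ℂ) • (ContinuousLinearMap.adjoint C) (y u) - f u‖ ^ 2 ≤ 0 := by
        by_contra hc
        push Not at hc
        have := mul_pos hA hc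
        rw [norm_zero] at h6
        linarith
      rw [map_smul]
      have h8 := pow_eq_zero_iff (two_ne_zero) |>.1 (le_antisymm h7 (by positivity))
      exact norm_eq_zero.1 h8
    have := adjoint_hasSum e C hC (((B⁻¹ : ℝ) : ℂ) • y u)
    rw [h5] at this
    exact this

end frame
section stft
open SchwartzMap LineDeriv

/-- The functional `t ↦ p · t`. -/
def dotL (p : Rn n) : Rn n →L[ℝ] ℝ := ∑ i, p i • ContinuousLinearMap.proj (R := ℝ) (φ := fun _ : Fin n => ℝ) i

lemma dotL_apply (p t : Rn n) : dotL p t = dot p t := by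
  simp [dotL, dot]

lemma abs_dot_le (p t : Rn n) : |dot p t| ≤ n * ‖p‖ * ‖t‖ := by
  unfold dot
  calc |∑ i, p i * t i| ≤ ∑ i, |p i * t i| := Finset.abs_sum_le_sum_abs _ _
    _ ≤ ∑ _i : Fin n, ‖p‖ * ‖t‖ := by
        refine Finset.sum_le_sum fun i _ => ?_
        rw [abs_mul]
        exact mul_le_mul (norm_le_pi_norm p i) (norm_le_pi_norm t i) (abs_nonneg _) (norm_nonneg _)
    _ = n * ‖p‖ * ‖t‖ := by simp; ring

lemma norm_dotL_le (p : Rn n) : ‖dotL p‖ ≤ n * ‖p‖ := by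
  refine ContinuousLinearMap.opNorm_le_bound _ (by positivity) fun t => ?_
  rw [dotL_apply]; exact abs_dot_le p t

/-- Character `e^{2π i p·t}`. -/
def ch (p : Rn n) (t : Rn n) : ℂ := Complex.exp ((2 * Real.pi * Complex.I : ℂ) * ((dot p t : ℝ) : ℂ))

lemma norm_ch (p t : Rn n) : ‖ch p t‖ = 1 := by
  unfold ch
  rw [show (2 * Real.pi * Complex.I : ℂ) * ((dot p t : ℝ) : ℂ) = ((2 * Real.pi * dot p t : ℝ) : ℂ) * Complex.I by
    push_cast; ring]
  exact Complex.norm_exp_ofReal_mul_I _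

lemma ch_eq_comp (p : Rn n) : ch p = (fun s : ℝ => Complex.exp ((2 * Real.pi * Complex.I : ℂ) * (s : ℂ))) ∘ (dotL p) := by
  funext t; simp [ch, dotL_apply]

lemma contDiff_e1 {N : WithTop ℕ∞} : ContDiff ℝ N (fun s : ℝ => Complex.exp ((2 * Real.pi * Complex.I : ℂ) * (s : ℂ))) :=
  Complex.contDiff_exp.comp (contDiff_const.mul Complex.ofRealCLM.contDiff)

lemma contDiff_ch {N : WithTop ℕ∞} (p : Rn n) : ContDiff ℝ N (ch p) := by
  rw [ch_eq_comp]; exact contDiff_e1.comp (dotL p).contDiff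

lemma iteratedDeriv_e1 (i : ℕ) : iteratedDeriv i (fun s : ℝ => Complex.exp ((2 * Real.pi * Complex.I : ℂ) * (s : ℂ)))
    = fun s : ℝ => (2 * Real.pi * Complex.I : ℂ) ^ i * Complex.exp ((2 * Real.pi * Complex.I : ℂ) * (s : ℂ)) := by
  induction i with
  | zero => simp
  | succ i ih =>
    rw [iteratedDeriv_succ, ih]
    funext s
    have h1 : HasDerivAt (fun s : ℝ => (2 * Real.pi * Complex.I : ℂ) * (s : ℂ)) (2 * Real.pi * Complex.I : ℂ) s := by
      simpa using (Complex.ofRealCLM.hasDerivAt (x := s)).const_mul (2 * Real.pi * Complex.I : ℂ)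
    have h2 := (h1.cexp).const_mul ((2 * Real.pi * Complex.I : ℂ) ^ i)
    rw [h2.deriv]; ring

lemma norm_iteratedFDeriv_ch (p t : Rn n) (i : ℕ) :
    ‖iteratedFDeriv ℝ i (ch p) t‖ ≤ (2 * Real.pi * (n * ‖p‖)) ^ i := by
  rw [ch_eq_comp, ContinuousLinearMap.iteratedFDeriv_comp_right (dotL p) (contDiff_e1 (N := ⊤)) t (i := i) le_top]
  refine (ContinuousMultilinearMap.norm_compContinuousLinearMap_le _ _).trans ?_
  rw [norm_iteratedFDeriv_eq_norm_iteratedDeriv, iteratedDeriv_e1]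
  simp only [Finset.prod_const, Finset.card_univ, Fintype.card_fin]
  have := norm_ch p t
  unfold ch at this
  rw [norm_mul, dotL_apply, this, mul_one, norm_pow, ← mul_pow]
  have h2 : ‖(2 * Real.pi * Complex.I : ℂ)‖ = 2 * Real.pi := by
    simp [abs_of_pos Real.pi_pos]
  rw [h2]
  gcongr
  exact norm_dotL_le p

lemma ch_temperate (p : Rn n) : (ch p).HasTemperateGrowth := by
  refine ⟨contDiff_ch p, fun i => ⟨0, (2 * Real.pi * (n * ‖p‖)) ^ i, fun x => ?_⟩⟩
  simpa using norm_iteratedFDeriv_ch p x i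

/-- Schwartz representative of the modulated translate. -/
def TS (x p : Rn n) : 𝓢(Rn n, ℂ) →L[ℂ] 𝓢(Rn n, ℂ) :=
  (smulLeftCLM ℂ (ch p)).comp (compSubConstCLM ℂ x)

lemma TS_apply (x p : Rn n) (g : 𝓢(Rn n, ℂ)) (t : Rn n) : TS x p g t = ch p t * g (t - x) := by
  simp [TS, smulLeftCLM_apply_apply (ch_temperate p)]

lemma TS_coe (x p : Rn n) (g : 𝓢(Rn n, ℂ)) : ⇑(TS x p g) = fun t => ch p t * g (t - x) :=
  funext (TS_apply x p g)

/-- Polynomial growth of Schwartz seminorms of time-frequency shifts. -/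
lemma TS_seminorm (g : 𝓢(Rn n, ℂ)) (k l : ℕ) : ∃ C, 0 ≤ C ∧ ∀ x p : Rn n,
    SchwartzMap.seminorm ℂ k l (TS x p g) ≤ C * (1 + ‖x‖ + ‖p‖) ^ (k + l) := by
  set q : ℝ := 1 + 2 * Real.pi * n with hq
  have hq1 : 1 ≤ q := by have := Real.pi_pos; rw [hq]; nlinarith [show (0:ℝ) ≤ n * Real.pi by positivity]
  set S : ℝ := 2 ^ k * ((Finset.Iic (k, l)).sup fun m => SchwartzMap.seminorm ℂ m.1 m.2) g with hS
  have hS0 : 0 ≤ S := by positivity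
  refine ⟨2 ^ l * q ^ l * S, by positivity, fun x p => ?_⟩
  refine SchwartzMap.seminorm_le_bound ℂ k l _ (by positivity) fun t => ?_
  have hb : ∀ i ≤ l, (1 + ‖t - x‖) ^ k * ‖iteratedFDeriv ℝ i (fun t => g (t - x)) t‖ ≤ S := by
    intro i hi
    rw [iteratedFDeriv_comp_sub]
    exact SchwartzMap.one_add_le_sup_seminorm_apply (𝕜 := ℂ) (m := (k, l)) le_rfl hi g (t - x)
  have ht : ‖t‖ ≤ (1 + ‖t - x‖) * (1 + ‖x‖ + ‖p‖) := by
    have h1 : ‖t‖ ≤ ‖t - x‖ + ‖x‖ := by simpa using norm_add_le (t - x) x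
    nlinarith [norm_nonneg (t - x), norm_nonneg x, norm_nonneg p, mul_nonneg (norm_nonneg (t - x)) (norm_nonneg x),
      mul_nonneg (norm_nonneg (t - x)) (norm_nonneg p)]
  have hR : 1 ≤ 1 + ‖x‖ + ‖p‖ := by linarith [norm_nonneg x, norm_nonneg p]
  set R := 1 + ‖x‖ + ‖p‖ with hRdef
  rw [TS_coe]
  have hd : ‖iteratedFDeriv ℝ l (fun t => ch p t * g (t - x)) t‖ ≤
      ∑ i ∈ Finset.range (l + 1), (l.choose i : ℝ) * ‖iteratedFDeriv ℝ i (ch p) t‖ *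
        ‖iteratedFDeriv ℝ (l - i) (fun t => g (t - x)) t‖ :=
    norm_iteratedFDeriv_mul_le (N := ((⊤ : ℕ∞) : WithTop ℕ∞)) (contDiff_ch p)
      ((g.smooth ⊤).comp (contDiff_id.sub contDiff_const)) t (by exact_mod_cast le_top)
  calc ‖t‖ ^ k * ‖iteratedFDeriv ℝ l (fun t => ch p t * g (t - x)) t‖
      ≤ ((1 + ‖t - x‖) * R) ^ k * ∑ i ∈ Finset.range (l + 1), (l.choose i : ℝ) * ‖iteratedFDeriv ℝ i (ch p) t‖ *
        ‖iteratedFDeriv ℝ (l - i) (fun t => g (t - x)) t‖ := by gcongr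
    _ = ∑ i ∈ Finset.range (l + 1), (l.choose i : ℝ) * (R ^ k * (‖iteratedFDeriv ℝ i (ch p) t‖ *
        ((1 + ‖t - x‖) ^ k * ‖iteratedFDeriv ℝ (l - i) (fun t => g (t - x)) t‖))) := by
        rw [Finset.mul_sum]; refine Finset.sum_congr rfl fun i _ => ?_; rw [mul_pow]; ring
    _ ≤ ∑ i ∈ Finset.range (l + 1), (l.choose i : ℝ) * (R ^ k * ((q * R) ^ l * S)) := by
        refine Finset.sum_le_sum fun i hi => ?_
        have hi' : i ≤ l := by simpa [Nat.lt_succ_iff] using hi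
        have h1 : ‖iteratedFDeriv ℝ i (ch p) t‖ ≤ (q * R) ^ l := by
          refine (norm_iteratedFDeriv_ch p t i).trans ?_
          have h3 : 2 * Real.pi * (n * ‖p‖) ≤ q * R := by
            have : 2 * Real.pi * (n * ‖p‖) = (2 * Real.pi * n) * ‖p‖ := by ring
            rw [this]
            apply mul_le_mul _ _ (norm_nonneg _) (by linarith)
            · rw [hq]; linarith
            · rw [hRdef]; linarith [norm_nonneg x]
          have h4 : 1 ≤ q * R := by nlinarith
          exact (pow_le_pow_left₀ (by positivity) h3 i).trans (pow_le_pow_right₀ h4 hi')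
        gcongr
        exact hb _ (Nat.sub_le _ _)
    _ = 2 ^ l * q ^ l * S * R ^ (k + l) := by
        rw [← Finset.sum_mul]
        have : (∑ i ∈ Finset.range (l + 1), (l.choose i : ℝ)) = 2 ^ l := by
          exact_mod_cast Nat.sum_range_choose l
        rw [this, mul_pow, pow_add]; ring

/-- Bilinear ambiguity function. -/
def Vf (g1 g2 : 𝓢(Rn n, ℂ)) (x p : Rn n) : ℂ := ∫ t, TS x p g1 t * g2 t

/-- multiplication by the coordinate -/
def cmul (j : Fin n) : 𝓢(Rn n, ℂ) →L[ℂ] 𝓢(Rn n, ℂ) := smulLeftCLM ℂ (fun t : Rn n => ((t j : ℝ) : ℂ))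

lemma cmul_apply (j : Fin n) (g : 𝓢(Rn n, ℂ)) (t : Rn n) : cmul j g t = (t j : ℂ) * g t := by
  have h : (fun t : Rn n => ((t j : ℝ) : ℂ)).HasTemperateGrowth := by
    have := (Complex.ofRealCLM.comp (ContinuousLinearMap.proj (R := ℝ) (φ := fun _ : Fin n => ℝ) j)).hasTemperateGrowth
    exact this
  simp [cmul, smulLeftCLM_apply_apply h]

lemma mul_integrable (f g : 𝓢(Rn n, ℂ)) : Integrable (fun t => f t * g t) := by
  have := (smulLeftCLM ℂ (⇑f) g).integrable (μ := volume)
  refine this.congr (Eventually.of_forall fun t => ?_)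
  simp [smulLeftCLM_apply_apply f.hasTemperateGrowth]

lemma Vf_x (g1 g2 : 𝓢(Rn n, ℂ)) (x p : Rn n) (j : Fin n) :
    (x j : ℂ) * Vf g1 g2 x p = Vf g1 (cmul j g2) x p - Vf (cmul j g1) g2 x p := by
  unfold Vf
  rw [← integral_sub (mul_integrable _ _) (mul_integrable _ _), ← integral_const_mul]
  congr 1; funext t
  rw [TS_apply, TS_apply, cmul_apply, cmul_apply]
  simp only [Pi.sub_apply]; push_cast; ring

lemma hasFDerivAt_ch (p t : Rn n) : HasFDerivAt (ch p)
    ((dotL p).smulRight ((2 * Real.pi * Complex.I : ℂ) * ch p t)) t := by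
  have h0 : HasFDerivAt (fun t : Rn n => ((dotL p t : ℝ) : ℂ)) (Complex.ofRealCLM.comp (dotL p)) t :=
    (Complex.ofRealCLM.comp (dotL p)).hasFDerivAt
  have h2 := (h0.const_mul (2 * Real.pi * Complex.I : ℂ)).cexp
  rw [ch_eq_comp]
  refine h2.congr_fderiv ?_
  ext v; simp [dotL_apply]; ring

lemma TS_lineDeriv (x p v t : Rn n) (g : 𝓢(Rn n, ℂ)) :
    (∂_{v} (TS x p g)) t = (2 * Real.pi * Complex.I : ℂ) * (dot p v : ℂ) * TS x p g t + TS x p (∂_{v} g) t := by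
  rw [lineDerivOp_apply_eq_fderiv, TS_coe]
  have h1 := hasFDerivAt_ch p t
  have h2 : HasFDerivAt (fun t => g (t - x)) (fderiv ℝ g (t - x)) t := by
    have := (g.hasFDerivAt (t - x)).comp t ((hasFDerivAt_id t).sub_const x)
    rw [ContinuousLinearMap.comp_id] at this
    exact this
  have h3 := h1.mul h2
  have h4 : HasFDerivAt (fun t => ch p t * g (t - x)) _ t := h3
  rw [h4.fderiv, TS_apply, lineDerivOp_apply_eq_fderiv]
  simp [dotL_apply]
  ring

lemma Vf_p (g1 g2 : 𝓢(Rn n, ℂ)) (x p v : Rn n) :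
    (2 * Real.pi * Complex.I : ℂ) * (dot p v : ℂ) * Vf g1 g2 x p =
      - Vf g1 (∂_{v} g2) x p - Vf (∂_{v} g1) g2 x p := by
  have h := integral_mul_lineDerivOp_right_eq_neg_left (μ := volume) (TS x p g1) g2 v
  unfold Vf
  rw [h, neg_neg, ← integral_sub (mul_integrable _ _) (mul_integrable _ _), ← integral_const_mul]
  congr 1; funext t
  rw [TS_lineDeriv]; ring

lemma dot_single (p : Rn n) (j : Fin n) : dot p (Pi.single j 1) = p j := by
  simp [dot, Pi.single_apply]

lemma norm_le_sum_abs (x : Rn n) : ‖x‖ ≤ ∑ j, |x j| := by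
  refine (pi_norm_le_iff_of_nonneg (Finset.sum_nonneg fun _ _ => abs_nonneg _)).2 fun j => ?_
  exact Finset.single_le_sum (f := fun j => |x j|) (fun _ _ => abs_nonneg _) (Finset.mem_univ j)

lemma Vf_decay (N : ℕ) : ∀ g1 g2 : 𝓢(Rn n, ℂ), ∃ C, 0 ≤ C ∧ ∀ x p, (1 + ‖x‖ + ‖p‖) ^ N * ‖Vf g1 g2 x p‖ ≤ C := by
  induction N with
  | zero =>
    intro g1 g2
    refine ⟨SchwartzMap.seminorm ℂ 0 0 g1 * ∫ t, ‖g2 t‖, by positivity, fun x p => ?_⟩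
    rw [pow_zero, one_mul, ← integral_const_mul]
    unfold Vf
    refine norm_integral_le_of_norm_le (g2.integrable.norm.const_mul _) (Eventually.of_forall fun t => ?_)
    rw [norm_mul, TS_apply, norm_mul, norm_ch, one_mul]
    gcongr
    exact SchwartzMap.norm_le_seminorm ℂ g1 _
  | succ N ih =>
    intro g1 g2
    choose C hC0 hC using ih
    refine ⟨C g1 g2 + ∑ j, (C g1 (cmul j g2) + C (cmul j g1) g2) +
      ∑ j, (C g1 (∂_{(Pi.single j 1 : Rn n)} g2) + C (∂_{(Pi.single j 1 : Rn n)} g1) g2), ?_, fun x p => ?_⟩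
    · have := fun a b => hC0 a b
      refine add_nonneg (add_nonneg (this _ _) (Finset.sum_nonneg fun j _ => add_nonneg (this _ _) (this _ _)))
        (Finset.sum_nonneg fun j _ => add_nonneg (this _ _) (this _ _))
    · set R := 1 + ‖x‖ + ‖p‖ with hR
      have hR0 : 0 ≤ R := by positivity
      have hx : ∀ j, R ^ N * (|x j| * ‖Vf g1 g2 x p‖) ≤ C g1 (cmul j g2) + C (cmul j g1) g2 := by
        intro j
        have h1 : |x j| * ‖Vf g1 g2 x p‖ = ‖(x j : ℂ) * Vf g1 g2 x p‖ := by simp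
        rw [h1, Vf_x]
        calc R ^ N * ‖Vf g1 (cmul j g2) x p - Vf (cmul j g1) g2 x p‖
            ≤ R ^ N * (‖Vf g1 (cmul j g2) x p‖ + ‖Vf (cmul j g1) g2 x p‖) := by
              gcongr; exact norm_sub_le _ _
          _ ≤ _ := by rw [mul_add]; exact add_le_add (hC _ _ x p) (hC _ _ x p)
      have hp : ∀ j, R ^ N * (|p j| * ‖Vf g1 g2 x p‖) ≤ C g1 (∂_{(Pi.single j 1 : Rn n)} g2) + C (∂_{(Pi.single j 1 : Rn n)} g1) g2 := by
        intro j
        have h1 : |p j| * ‖Vf g1 g2 x p‖ ≤ ‖(2 * Real.pi * Complex.I : ℂ) * (dot p (Pi.single j 1) : ℂ) * Vf g1 g2 x p‖ := by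
          rw [dot_single]
          simp only [norm_mul, Complex.norm_I, Complex.norm_real, Complex.norm_ofNat, mul_one, Real.norm_eq_abs,
            abs_of_pos Real.pi_pos]
          have : 1 ≤ 2 * Real.pi := by linarith [Real.pi_gt_three]
          gcongr
          nlinarith [abs_nonneg (p j)]
        refine (mul_le_mul_of_nonneg_left h1 (by positivity)).trans ?_
        rw [Vf_p]
        calc R ^ N * ‖-Vf g1 (∂_{(Pi.single j 1 : Rn n)} g2) x p - Vf (∂_{(Pi.single j 1 : Rn n)} g1) g2 x p‖
            ≤ R ^ N * (‖Vf g1 (∂_{(Pi.single j 1 : Rn n)} g2) x p‖ + ‖Vf (∂_{(Pi.single j 1 : Rn n)} g1) g2 x p‖) := by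
              gcongr; refine (norm_sub_le _ _).trans ?_; rw [norm_neg]
          _ ≤ _ := by rw [mul_add]; exact add_le_add (hC _ _ x p) (hC _ _ x p)
      calc R ^ (N + 1) * ‖Vf g1 g2 x p‖ = R ^ N * ((1 + ‖x‖ + ‖p‖) * ‖Vf g1 g2 x p‖) := by rw [pow_succ, ← hR]; ring
        _ ≤ R ^ N * ((1 + (∑ j, |x j|) + (∑ j, |p j|)) * ‖Vf g1 g2 x p‖) := by
            gcongr
            · exact norm_le_sum_abs x
            · exact norm_le_sum_abs p
        _ = R ^ N * ‖Vf g1 g2 x p‖ + ∑ j, R ^ N * (|x j| * ‖Vf g1 g2 x p‖) + ∑ j, R ^ N * (|p j| * ‖Vf g1 g2 x p‖) := by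
            rw [← Finset.mul_sum, ← Finset.mul_sum, ← Finset.sum_mul, ← Finset.sum_mul]; ring
        _ ≤ _ := by
            refine add_le_add (add_le_add (hC _ _ x p) ?_) ?_
            · exact Finset.sum_le_sum fun j _ => hx j
            · exact Finset.sum_le_sum fun j _ => hp j

end stft
section schwartzSums
open SchwartzMap

lemma schwartz_sum_aux {ι : Type} (a : ι → 𝓢(Rn n, ℂ))
    (ha : ∀ k l, Summable fun i => SchwartzMap.seminorm ℂ k l (a i)) :
    ∃ F : 𝓢(Rn n, ℂ), (∀ t, HasSum (fun i => a i t) (F t)) ∧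
      ∀ k l, SchwartzMap.seminorm ℂ k l F ≤ ∑' i, SchwartzMap.seminorm ℂ k l (a i) := by
  have hf : ∀ i, ContDiff ℝ ((⊤ : ℕ∞) : WithTop ℕ∞) (a i) := fun i => (a i).smooth ⊤
  have hb : ∀ (k : ℕ) (i : ι) (x : Rn n), (k : ℕ∞) ≤ ⊤ →
      ‖iteratedFDeriv ℝ k (a i) x‖ ≤ SchwartzMap.seminorm ℂ 0 k (a i) :=
    fun k i x _ => SchwartzMap.norm_iteratedFDeriv_le_seminorm ℂ (a i) k x
  have hv : ∀ k : ℕ, (k : ℕ∞) ≤ ⊤ → Summable fun i => SchwartzMap.seminorm ℂ 0 k (a i) := fun k _ => ha 0 k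
  have key : ∀ k l (x : Rn n), ‖x‖ ^ k * ‖iteratedFDeriv ℝ l (fun t => ∑' i, a i t) x‖ ≤
      ∑' i, SchwartzMap.seminorm ℂ k l (a i) := by
    intro k l x
    rw [iteratedFDeriv_tsum_apply hf hv hb le_top]
    have hs : Summable fun i => ‖iteratedFDeriv ℝ l (a i) x‖ :=
      Summable.of_nonneg_of_le (fun _ => norm_nonneg _) (fun i => hb l i x le_top) (ha 0 l)
    calc ‖x‖ ^ k * ‖∑' i, iteratedFDeriv ℝ l (a i) x‖
        ≤ ‖x‖ ^ k * ∑' i, ‖iteratedFDeriv ℝ l (a i) x‖ := by gcongr; exact norm_tsum_le_tsum_norm hs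
      _ = ∑' i, ‖x‖ ^ k * ‖iteratedFDeriv ℝ l (a i) x‖ := by rw [tsum_mul_left]
      _ ≤ _ := (hs.mul_left _).tsum_le_tsum (fun i => SchwartzMap.le_seminorm ℂ k l (a i) x) (ha k l)
  refine ⟨⟨fun t => ∑' i, a i t, contDiff_tsum hf hv hb, fun k l => ⟨_, key k l⟩⟩, fun t => ?_, fun k l => ?_⟩
  · have : Summable fun i => a i t :=
      Summable.of_norm_bounded (ha 0 0) fun i => SchwartzMap.norm_le_seminorm ℂ (a i) t
    exact this.hasSum
  · exact SchwartzMap.seminorm_le_bound ℂ k l _ (tsum_nonneg fun i => apply_nonneg _ _) (key k l)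

lemma schwartz_sum {ι : Type} (a : ι → 𝓢(Rn n, ℂ))
    (ha : ∀ k l, Summable fun i => SchwartzMap.seminorm ℂ k l (a i)) :
    ∃ F : 𝓢(Rn n, ℂ), HasSum a F := by
  classical
  obtain ⟨F, hF, -⟩ := schwartz_sum_aux a ha
  refine ⟨F, ?_⟩
  unfold HasSum
  rw [SummationFilter.unconditional_filter, (schwartz_withSeminorms ℂ (Rn n) ℂ).tendsto_nhds]
  rintro ⟨k, l⟩ ε hε
  have h0 := tendsto_tsum_compl_atTop_zero (fun i => SchwartzMap.seminorm ℂ k l (a i))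
  filter_upwards [h0.eventually (gt_mem_nhds hε)] with s hs
  refine lt_of_le_of_lt ?_ hs
  obtain ⟨G, hG, hGs⟩ := schwartz_sum_aux (fun i : {x // x ∉ s} => a i) (fun k l => (ha k l).subtype _)
  have hFG : ∑ i ∈ s, a i - F = - G := by
    ext t
    have h1 : HasSum (fun i => a i t) (G t + ∑ i ∈ s, a i t) := s.hasSum_compl_iff.1 (hG t)
    have h2 := (hF t).unique h1
    have h3 : (∑ i ∈ s, a i) t = ∑ i ∈ s, a i t := by
      simp
    rw [sub_apply, h3, h2, neg_apply]; ring
  rw [hFG]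
  change SchwartzMap.seminorm ℂ k l (-G) ≤ _
  rw [map_neg_eq_map]
  exact hGs k l

/-- conjugation -/
def conjS : 𝓢(Rn n, ℂ) →L[ℝ] 𝓢(Rn n, ℂ) := postcompCLM (𝕜 := ℝ) (Complex.conjCLE : ℂ →L[ℝ] ℂ)

lemma conjS_apply (g : 𝓢(Rn n, ℂ)) (t : Rn n) : conjS g t = conj (g t) := by
  simp [conjS]

/-- phase -/
def ph (z : Ph n) : ℂ := Complex.exp (((-(Real.pi * dot z.1 z.2) : ℝ) : ℂ) * Complex.I)

lemma norm_ph (z : Ph n) : ‖ph z‖ = 1 := Complex.norm_exp_ofReal_mul_I _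

/-- Schwartz representative of `T1 z g`. -/
def TF (z : Ph n) (g : 𝓢(Rn n, ℂ)) : 𝓢(Rn n, ℂ) := ph z • TS z.1 z.2 g

lemma TF_apply' (z : Ph n) (g : 𝓢(Rn n, ℂ)) (t : Rn n) : TF z g t = ph z * (ch z.2 t * g (t - z.1)) := by
  simp [TF, TS_apply]

lemma TF_apply (z : Ph n) (g : 𝓢(Rn n, ℂ)) (t : Rn n) : TF z g t = T1 z g t := by
  rw [TF_apply']
  unfold T1 WH ph ch
  rw [← mul_assoc, ← Complex.exp_add]
  congr 2
  push_cast
  field_simp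
  ring

lemma TF_seminorm (g : 𝓢(Rn n, ℂ)) (k l : ℕ) : ∃ C, 0 ≤ C ∧ ∀ z : Ph n,
    SchwartzMap.seminorm ℂ k l (TF z g) ≤ C * (1 + ‖z‖) ^ (k + l) := by
  obtain ⟨C, hC0, hC⟩ := TS_seminorm g k l
  refine ⟨C * 2 ^ (k + l), by positivity, fun z => ?_⟩
  unfold TF
  rw [map_smul_eq_mul, norm_ph, one_mul]
  refine (hC z.1 z.2).trans ?_
  rw [mul_assoc, ← mul_pow]
  have h1 : ‖z.1‖ ≤ ‖z‖ := norm_fst_le z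
  have h2 : ‖z.2‖ ≤ ‖z‖ := norm_snd_le z
  gcongr
  linarith

lemma ch_add_right (p t x : Rn n) : ch p (t + x) = ch p t * ch p x := by
  unfold ch
  rw [← Complex.exp_add]
  congr 1
  have : dot p (t + x) = dot p t + dot p x := by
    simp [dot, mul_add, Finset.sum_add_distrib]
  rw [this]; push_cast; ring

lemma conj_ch_mul (p q t : Rn n) : conj (ch p t) * ch q t = ch (q - p) t := by
  unfold ch
  rw [← Complex.exp_conj, ← Complex.exp_add]
  congr 1
  have : dot (q - p) t = dot q t - dot p t := by
    simp [dot, sub_mul, Finset.sum_sub_distrib]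
  rw [this]
  simp only [map_mul, Complex.conj_ofReal, Complex.conj_I, map_ofNat]
  push_cast
  ring

lemma gram_decay (g : 𝓢(Rn n, ℂ)) (N : ℕ) : ∃ C, 0 ≤ C ∧ ∀ z w : Ph n,
    ‖inner ℂ ((TF z g).toLp 2) ((TF w g).toLp 2)‖ ≤ C * ((1 + ‖z - w‖) ^ N)⁻¹ := by
  obtain ⟨C, hC0, hC⟩ := Vf_decay N g (conjS g)
  refine ⟨C, hC0, fun z w => ?_⟩
  have h1 : inner ℂ ((TF z g).toLp 2) ((TF w g).toLp 2) =
      (conj (ph z * ch z.2 z.1) * (ph w * ch w.2 z.1)) * Vf g (conjS g) (w.1 - z.1) (w.2 - z.2) := by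
    rw [SchwartzMap.inner_toL2_toL2_eq (TF z g) (TF w g) volume]
    rw [← integral_add_right_eq_self (fun t => inner ℂ (TF z g t) (TF w g t)) z.1]
    unfold Vf
    rw [← integral_const_mul]
    congr 1; funext t
    rw [TS_apply, conjS_apply, TF_apply', TF_apply', ← conj_ch_mul, ch_add_right, ch_add_right]
    have e1 : t + z.1 - z.1 = t := by abel
    have e2 : t + z.1 - w.1 = t - (w.1 - z.1) := by abel
    rw [e1, e2, RCLike.inner_apply]
    simp only [map_mul]
    ring
  rw [h1]
  have h2 : ‖conj (ph z * ch z.2 z.1) * (ph w * ch w.2 z.1)‖ = 1 := by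
    rw [norm_mul, RCLike.norm_conj, norm_mul, norm_mul, norm_ph, norm_ph, norm_ch, norm_ch]; norm_num
  rw [norm_mul, h2, one_mul, ← div_eq_mul_inv, le_div_iff₀ (by positivity), mul_comm]
  refine le_trans ?_ (hC (w.1 - z.1) (w.2 - z.2))
  have h3 : ‖z - w‖ ≤ ‖w.1 - z.1‖ + ‖w.2 - z.2‖ := by
    rw [norm_sub_rev, Prod.norm_def]
    have := norm_nonneg (w.1 - z.1)
    have := norm_nonneg (w.2 - z.2)
    simp only [Prod.fst_sub, Prod.snd_sub]
    rcases max_cases ‖w.1 - z.1‖ ‖w.2 - z.2‖ with h | h <;> linarith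
  refine mul_le_mul_of_nonneg_right (pow_le_pow_left₀ (by positivity) (by linarith) N) (norm_nonneg _)

end schwartzSums
section lattice

lemma summable_1d (a : ℝ) (ha : 0 < a) : Summable fun k : ℤ => ((1 + a * |(k : ℝ)|) ^ 2)⁻¹ := by
  have h := (Real.summable_one_div_int_pow (p := 2)).2 one_lt_two
  refine Summable.of_norm_bounded_eventually (g := fun k : ℤ => (a ^ 2)⁻¹ * (1 / (k : ℝ) ^ 2)) (h.mul_left _) ?_
  have : ({0} : Set ℤ)ᶜ ∈ (cofinite : Filter ℤ) := (Set.finite_singleton 0).compl_mem_cofinite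
  filter_upwards [this] with k hk
  have hk0 : (k : ℝ) ≠ 0 := by exact_mod_cast hk
  have hk1 : 0 < |(k : ℝ)| := abs_pos.2 hk0
  rw [Real.norm_of_nonneg (by positivity), one_div, ← mul_inv, ← sq_abs (k : ℝ), ← mul_pow]
  gcongr
  linarith

lemma sum_1d (a : ℝ) (ha : 0 < a) : ∃ K, 0 ≤ K ∧ ∀ (r : ℝ) (s : Finset ℤ),
    ∑ k ∈ s, ((1 + |a * (k : ℝ) - r|) ^ 2)⁻¹ ≤ K := by
  have hs := summable_1d a ha
  refine ⟨(1 + a) ^ 2 * ∑' k : ℤ, ((1 + a * |(k : ℝ)|) ^ 2)⁻¹, by positivity, fun r s => ?_⟩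
  set m : ℤ := ⌊r / a⌋ with hm
  have h1 : (m : ℝ) * a ≤ r := by
    have := Int.floor_le (r / a); rwa [le_div_iff₀ ha] at this
  have h2 : r ≤ (m : ℝ) * a + a := by
    have := (Int.lt_floor_add_one (r / a)).le
    rw [div_le_iff₀ ha] at this; rw [hm]; linarith
  have hsh : Summable fun k : ℤ => ((1 + a * |((k - m : ℤ) : ℝ)|) ^ 2)⁻¹ :=
    (Equiv.subRight m).summable_iff (f := fun k : ℤ => ((1 + a * |(k : ℝ)|) ^ 2)⁻¹) |>.2 hs
  have hts : ∑' k : ℤ, ((1 + a * |((k - m : ℤ) : ℝ)|) ^ 2)⁻¹ = ∑' k : ℤ, ((1 + a * |(k : ℝ)|) ^ 2)⁻¹ :=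
    (Equiv.subRight m).tsum_eq (fun k : ℤ => ((1 + a * |(k : ℝ)|) ^ 2)⁻¹)
  calc ∑ k ∈ s, ((1 + |a * (k : ℝ) - r|) ^ 2)⁻¹
      ≤ ∑ k ∈ s, (1 + a) ^ 2 * ((1 + a * |((k - m : ℤ) : ℝ)|) ^ 2)⁻¹ := by
        refine Finset.sum_le_sum fun k _ => ?_
        have h3 : a * |((k - m : ℤ) : ℝ)| ≤ |a * (k : ℝ) - r| + a := by
          rw [← abs_of_pos ha, ← abs_mul, abs_of_pos ha]
          push_cast
          have : a * ((k : ℝ) - m) = (a * k - r) + (r - m * a) := by ring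
          rw [this]
          refine (abs_add_le _ _).trans ?_
          have : |r - m * a| ≤ a := by rw [abs_le]; constructor <;> linarith
          linarith
        have h4 : 1 + a * |((k - m : ℤ) : ℝ)| ≤ (1 + a) * (1 + |a * (k : ℝ) - r|) := by
          nlinarith [abs_nonneg (a * (k : ℝ) - r)]
        rw [← div_eq_mul_inv, le_div_iff₀ (by positivity), ← div_eq_inv_mul, div_le_iff₀ (by positivity), ← mul_pow]
        gcongr
    _ = (1 + a) ^ 2 * ∑ k ∈ s, ((1 + a * |((k - m : ℤ) : ℝ)|) ^ 2)⁻¹ := by rw [Finset.mul_sum]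
    _ ≤ _ := by
        rw [← hts]
        gcongr
        exact hsh.sum_le_tsum s fun _ _ => by positivity

lemma sum_pi (f : Fin n → ℤ → ℝ) (hf : ∀ i k, 0 ≤ f i k) (K : ℝ)
    (h : ∀ i (s : Finset ℤ), ∑ k ∈ s, f i k ≤ K) (s : Finset (Fin n → ℤ)) :
    ∑ k ∈ s, ∏ i, f i (k i) ≤ K ^ n := by
  classical
  calc ∑ k ∈ s, ∏ i, f i (k i)
      ≤ ∑ k ∈ Fintype.piFinset (fun i => s.image fun k => k i), ∏ i, f i (k i) := by
        refine Finset.sum_le_sum_of_subset_of_nonneg (fun k hk => ?_) fun k _ _ => Finset.prod_nonneg fun i _ => hf i _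
        rw [Fintype.mem_piFinset]
        exact fun i => Finset.mem_image_of_mem _ hk
    _ = ∏ i, ∑ k ∈ s.image (fun k => k i), f i k := (Finset.prod_univ_sum _ _).symm
    _ ≤ ∏ _i : Fin n, K := Finset.prod_le_prod (fun i _ => Finset.sum_nonneg fun _ _ => hf i _) fun i _ => h i _
    _ = K ^ n := by simp

lemma sum_prod_le {X Y : Type} (f : X → ℝ) (g : Y → ℝ) (hf : ∀ x, 0 ≤ f x) (hg : ∀ y, 0 ≤ g y) (K L : ℝ)
    (hK : 0 ≤ K)
    (h1 : ∀ s : Finset X, ∑ x ∈ s, f x ≤ K) (h2 : ∀ s : Finset Y, ∑ x ∈ s, g x ≤ L) (s : Finset (X × Y)) :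
    ∑ k ∈ s, f k.1 * g k.2 ≤ K * L := by
  classical
  calc ∑ k ∈ s, f k.1 * g k.2 ≤ ∑ k ∈ (s.image Prod.fst) ×ˢ (s.image Prod.snd), f k.1 * g k.2 := by
        refine Finset.sum_le_sum_of_subset_of_nonneg (fun k hk => ?_) fun k _ _ => mul_nonneg (hf _) (hg _)
        rw [Finset.mem_product]
        exact ⟨Finset.mem_image_of_mem _ hk, Finset.mem_image_of_mem _ hk⟩
    _ = (∑ x ∈ s.image Prod.fst, f x) * ∑ y ∈ s.image Prod.snd, g y := by
        rw [Finset.sum_product, Finset.sum_mul_sum]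
    _ ≤ K * L := mul_le_mul (h1 _) (h2 _) (Finset.sum_nonneg fun _ _ => hg _) hK

lemma lattice_sum (α β : ℝ) (hα : 0 < α) (hβ : 0 < β) : ∃ K, 0 ≤ K ∧ ∀ u : Ph n,
    Summable (fun k => ((1 + ‖latt α β k - u‖) ^ (4 * n))⁻¹) ∧
    ∑' k, ((1 + ‖latt α β k - u‖) ^ (4 * n))⁻¹ ≤ K := by
  obtain ⟨K1, hK1, h1⟩ := sum_1d α hα
  obtain ⟨K2, hK2, h2⟩ := sum_1d β hβ
  refine ⟨K1 ^ n * K2 ^ n, by positivity, fun u => ?_⟩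
  have key : ∀ s : Finset ((Fin n → ℤ) × (Fin n → ℤ)),
      ∑ k ∈ s, ((1 + ‖latt α β k - u‖) ^ (4 * n))⁻¹ ≤ K1 ^ n * K2 ^ n := by
    intro s
    have hA := sum_pi (n := n) (fun i k => ((1 + |α * (k : ℝ) - u.1 i|) ^ 2)⁻¹) (fun i k => by positivity) K1
      (fun i s => h1 (u.1 i) s)
    have hB := sum_pi (n := n) (fun i k => ((1 + |β * (k : ℝ) - u.2 i|) ^ 2)⁻¹) (fun i k => by positivity) K2
      (fun i s => h2 (u.2 i) s)
    refine le_trans (Finset.sum_le_sum fun k _ => ?_) (sum_prod_le _ _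
      (fun x => Finset.prod_nonneg fun i _ => by positivity)
      (fun x => Finset.prod_nonneg fun i _ => by positivity) _ _ (by positivity) hA hB s)
    set R := 1 + ‖latt α β k - u‖ with hR
    have hR0 : 0 < R := by positivity
    have a1 : ∀ i, 1 + |α * (k.1 i : ℝ) - u.1 i| ≤ R := by
      intro i
      have e1 : |α * (k.1 i : ℝ) - u.1 i| = ‖(latt α β k - u).1 i‖ := by
        simp [latt, iC]
      have := norm_le_pi_norm (latt α β k - u).1 i
      have := norm_fst_le (latt α β k - u)
      rw [e1]; linarith
    have a2 : ∀ i, 1 + |β * (k.2 i : ℝ) - u.2 i| ≤ R := by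
      intro i
      have e1 : |β * (k.2 i : ℝ) - u.2 i| = ‖(latt α β k - u).2 i‖ := by
        simp [latt, iC]
      have := norm_le_pi_norm (latt α β k - u).2 i
      have := norm_snd_le (latt α β k - u)
      rw [e1]; linarith
    have e : (R ^ (4 * n))⁻¹ = (∏ _i : Fin n, (R ^ 2)⁻¹) * ∏ _i : Fin n, (R ^ 2)⁻¹ := by
      simp only [Finset.prod_const, Finset.card_univ, Fintype.card_fin]
      rw [← mul_pow, ← mul_inv, ← pow_add, inv_pow, ← pow_mul]
    rw [e]
    gcongr with i _ i _
    · exact a1 i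
    · exact a2 i
  have hsum := summable_of_sum_le (fun k => by positivity) key
  exact ⟨hsum, Real.tsum_le_of_sum_le (fun k => by positivity) key⟩

end lattice
section bridging
open SchwartzMap

lemma latt_sub (α β : ℝ) (i j : (Fin n → ℤ) × (Fin n → ℤ)) : latt α β (i - j) = latt α β i - latt α β j := by
  ext x <;> simp [latt, iC, mul_sub]

lemma l2normSq_eq (f : Lp ℂ 2 (volume : Measure (Rn n))) : l2normSq (⇑f) = ‖f‖ ^ 2 := by
  have h3 : (inner ℂ f f : ℂ) = ((‖f‖ ^ 2 : ℝ) : ℂ) := by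
    rw [inner_self_eq_norm_sq_to_K]; simp
  rw [L2.inner_def] at h3
  have h4 : (∫ a, inner ℂ (f a) (f a) : ℂ) = ((∫ a, ‖f a‖ ^ 2 : ℝ) : ℂ) := by
    rw [← integral_complex_ofReal]
    congr 1; funext a
    rw [inner_self_eq_norm_sq_to_K]; simp
  rw [h4] at h3
  exact_mod_cast h3

set_option maxHeartbeats 1000000 in
lemma frame_real (g : 𝓢(Rn n, ℂ)) (α β A B : ℝ) (hA : 0 < A) (hAB : A ≤ B)
    (hF : FrameBounds A B (fun k => T1 (latt α β k) ⇑g)) (f : Lp ℂ 2 (volume : Measure (Rn n))) :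
    Summable (fun k => ‖inner ℂ ((TF (latt α β k) g).toLp 2) f‖ ^ 2) ∧
    A * ‖f‖ ^ 2 ≤ ∑' k, ‖inner ℂ ((TF (latt α β k) g).toLp 2) f‖ ^ 2 ∧
    ∑' k, ‖inner ℂ ((TF (latt α β k) g).toLp 2) f‖ ^ 2 ≤ B * ‖f‖ ^ 2 := by
  have hB : 0 ≤ B := hA.le.trans hAB
  obtain ⟨h1, h2⟩ := hF f (Lp.memLp f)
  have hn : l2normSq (⇑f) = ‖f‖ ^ 2 := l2normSq_eq f
  have hi : ∀ k, l2inner (⇑f) (T1 (latt α β k) ⇑g) = inner ℂ ((TF (latt α β k) g).toLp 2) f := by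
    intro k
    rw [L2.inner_def]
    unfold l2inner
    refine integral_congr_ae ?_
    filter_upwards [(TF (latt α β k) g).coeFn_toLp 2 volume] with t ht
    rw [ht, TF_apply, RCLike.inner_apply]
  have he : ∀ k, (‖l2inner (⇑f) (T1 (latt α β k) ⇑g)‖₊ : ℝ≥0∞) ^ 2 =
      ENNReal.ofReal (‖inner ℂ ((TF (latt α β k) g).toLp 2) f‖ ^ 2) := by
    intro k
    rw [hi, ENNReal.ofReal_pow (norm_nonneg _), ofReal_norm]
    rfl
  simp only [he, hn] at h1 h2
  have hs : Summable (fun k => ‖inner ℂ ((TF (latt α β k) g).toLp 2) f‖ ^ 2) := by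
    have := ENNReal.summable_toReal (ne_top_of_le_ne_top ENNReal.ofReal_ne_top h2)
    refine this.congr fun k => ?_
    rw [ENNReal.toReal_ofReal (by positivity)]
  rw [← ENNReal.ofReal_tsum_of_nonneg (fun k => by positivity) hs] at h1 h2
  refine ⟨hs, ?_, ?_⟩
  · exact (ENNReal.ofReal_le_ofReal_iff (tsum_nonneg fun k => by positivity)).1 h1
  · exact (ENNReal.ofReal_le_ofReal_iff (by positivity)).1 h2

theorem gabor_expand (g : 𝓢(Rn n, ℂ)) (α β : ℝ) (hα : 0 < α) (hβ : 0 < β)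
    (hframe : IsFrame (fun k => T1 (latt α β k) ⇑g)) :
    ∃ c : Ph n → (Fin n → ℤ) × (Fin n → ℤ) → ℂ,
      (∀ N : ℕ, ∃ a, 0 ≤ a ∧ ∀ u k, ‖c u k‖ ≤ a * ((1 + ‖latt α β k - u‖) ^ N)⁻¹) ∧
      ∀ u, HasSum (fun k => c u k • TF (latt α β k) g) (TF u g) := by
  obtain ⟨A, B, hA, hAB, hF⟩ := hframe
  obtain ⟨K, hK0, hK⟩ := lattice_sum (n := n) α β hα hβ
  have hfr := frame_real g α β A B hA hAB hF
  obtain ⟨c, hc, hcs⟩ := abstract_coeffs (fun k => (TF (latt α β k) g).toLp 2 volume) A B hA hAB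
    (fun f => (hfr f).1) (fun f => (hfr f).2.1) (fun f => (hfr f).2.2)
    (fun (u : Ph n) k => ‖latt α β k - u‖) (fun k => ‖latt α β k‖) (fun _ _ => norm_nonneg _) (fun _ => norm_nonneg _)
    (fun u i j => by
      rw [latt_sub]
      have := abs_norm_sub_norm_le (latt α β i - u) (latt α β j - u)
      rwa [sub_sub_sub_cancel_right] at this)
    (4 * n) (by simpa using (hK 0).1) K hK
    (fun N => by
      obtain ⟨C, hC0, hC⟩ := gram_decay g N
      refine ⟨C, hC0, fun i j => ?_⟩
      rw [latt_sub]; exact hC _ _)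
    (fun u => (TF u g).toLp 2 volume)
    (fun N => by
      obtain ⟨C, hC0, hC⟩ := gram_decay g N
      exact ⟨C, hC0, fun u i => hC _ _⟩)
  refine ⟨c, hc, fun u => ?_⟩
  obtain ⟨F, hFs⟩ := schwartz_sum (fun k => c u k • TF (latt α β k) g) (by
    intro k l
    obtain ⟨C, hC0, hC⟩ := TF_seminorm g k l
    obtain ⟨a, ha0, ha⟩ := hc (4 * n + (k + l))
    refine Summable.of_nonneg_of_le (fun _ => apply_nonneg _ _) (fun i => ?_)
      (((hK u).1).mul_left (a * C * (1 + ‖u‖) ^ (k + l)))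
    rw [map_smul_eq_mul]
    have h1 := ha u i
    have h2 := hC (latt α β i)
    have h3 : 1 + ‖latt α β i‖ ≤ (1 + ‖u‖) * (1 + ‖latt α β i - u‖) := by
      have : ‖latt α β i‖ ≤ ‖latt α β i - u‖ + ‖u‖ := by simpa using norm_add_le (latt α β i - u) u
      nlinarith [norm_nonneg u, norm_nonneg (latt α β i - u), mul_nonneg (norm_nonneg u) (norm_nonneg (latt α β i - u))]
    calc ‖c u i‖ * SchwartzMap.seminorm ℂ k l (TF (latt α β i) g)
        ≤ (a * ((1 + ‖latt α β i - u‖) ^ (4 * n + (k + l)))⁻¹) * (C * ((1 + ‖u‖) * (1 + ‖latt α β i - u‖)) ^ (k + l)) := by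
          refine mul_le_mul h1 (h2.trans ?_) (apply_nonneg _ _) (by positivity)
          gcongr
      _ = a * C * (1 + ‖u‖) ^ (k + l) * ((1 + ‖latt α β i - u‖) ^ (4 * n))⁻¹ := by
          have : (1 + ‖latt α β i - u‖) ≠ 0 := by positivity
          rw [mul_pow, pow_add _ (4 * n) (k + l)]
          field_simp)
  have h1 := (toLpCLM ℂ ℂ 2 (volume : Measure (Rn n))).hasSum hFs
  have h2 := hcs u
  have h3 : (fun k => (toLpCLM ℂ ℂ 2 (volume : Measure (Rn n))) (c u k • TF (latt α β k) g)) =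
      fun k => c u k • (TF (latt α β k) g).toLp 2 volume := by
    funext k; rw [map_smul]; rfl
  have h1' : HasSum (fun k => c u k • (TF (latt α β k) g).toLp 2 volume) (F.toLp 2 volume) := by
    rw [← h3]; exact h1
  have h4 := h1'.unique h2
  have h5 : F = TF u g := injective_toLp 2 volume h4
  rw [← h5]; exact hFs

end bridging
section final
open SchwartzMap

/-- Dilation on Schwartz space by `r⁻¹`. -/
def DS (r : ℝ) (hr : r ≠ 0) : 𝓢(Rn n, ℂ) →L[ℂ] 𝓢(Rn n, ℂ) :=
  (((r⁻¹ ^ ((n : ℝ) / 2) : ℝ) : ℂ)) •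
    compCLMOfContinuousLinearEquiv ℂ (ContinuousLinearEquiv.smulLeft (R₁ := ℝ) (M₁ := Rn n) (Units.mk0 r⁻¹ (inv_ne_zero hr)))

lemma DS_apply (r : ℝ) (hr : r ≠ 0) (f : 𝓢(Rn n, ℂ)) (t : Rn n) :
    DS r hr f t = Dil r⁻¹ f t := by
  simp only [DS, Dil, smul_apply, smul_eq_mul]
  rfl

lemma dot_smul_left (a : ℝ) (x y : Rn n) : dot (a • x) y = a * dot x y := by
  simp [dot, Finset.mul_sum, mul_assoc]

lemma dot_smul_right (a : ℝ) (x y : Rn n) : dot x (a • y) = a * dot x y := by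
  simp [dot, Finset.mul_sum, mul_left_comm]

lemma DS_TF (hbar r : ℝ) (hh : 0 < hbar) (hr : 0 < r) (hrh : r ^ 2 = 2 * Real.pi * hbar)
    (z : Ph n) (g : 𝓢(Rn n, ℂ)) (t : Rn n) :
    DS r hr.ne' (TF z g) t = WH hbar (r • z) (Dil r⁻¹ ⇑g) t := by
  rw [DS_apply]
  unfold Dil WH
  rw [TF_apply]
  unfold T1 WH
  have e1 : r⁻¹ • (t - (r • z).1) = r⁻¹ • t - z.1 := by
    rw [smul_sub, Prod.smul_fst, smul_smul, inv_mul_cancel₀ hr.ne', one_smul]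
  beta_reduce
  rw [e1, dot_smul_right, Prod.smul_fst, Prod.smul_snd, dot_smul_left, dot_smul_left, dot_smul_right]
  have e2 : (1 / (2 * Real.pi))⁻¹ * (r⁻¹ * dot z.2 t - dot z.1 z.2 / 2) =
      hbar⁻¹ * (r * dot z.2 t - r * (r * dot z.1 z.2) / 2) := by
    have : hbar = r ^ 2 / (2 * Real.pi) := by rw [hrh]; field_simp
    rw [this]
    have := hr.ne'
    field_simp
  rw [e2]; ring

lemma sq2_nonneg (z : Ph n) : 0 ≤ sq2 z := by
  unfold sq2 sq
  exact add_nonneg (Finset.sum_nonneg fun _ _ => by positivity) (Finset.sum_nonneg fun _ _ => by positivity)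

lemma sq_le (x : Rn n) : sq x ≤ n * ‖x‖ ^ 2 := by
  unfold sq
  calc ∑ i, x i ^ 2 ≤ ∑ _i : Fin n, ‖x‖ ^ 2 := by
        refine Finset.sum_le_sum fun i _ => ?_
        rw [← sq_abs]
        exact pow_le_pow_left₀ (abs_nonneg _) (norm_le_pi_norm x i) 2
    _ = n * ‖x‖ ^ 2 := by simp

lemma sq_add_le (x y : Rn n) : sq (x + y) ≤ 2 * sq x + 2 * sq y := by
  unfold sq
  rw [Finset.mul_sum, Finset.mul_sum, ← Finset.sum_add_distrib]
  refine Finset.sum_le_sum fun i _ => ?_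
  simp only [Pi.add_apply]
  nlinarith [sq_nonneg (x i - y i)]

lemma sq2_shift (a b : Ph n) : 1 + sq2 b ≤ (2 + 4 * n) * (1 + ‖a - b‖) ^ 2 * (1 + sq2 a) := by
  have h1 : sq2 b ≤ 2 * sq2 a + 2 * sq2 (b - a) := by
    have e1 := sq_add_le a.1 (b.1 - a.1)
    have e2 := sq_add_le a.2 (b.2 - a.2)
    rw [add_sub_cancel] at e1 e2
    unfold sq2
    simp only [Prod.fst_sub, Prod.snd_sub]
    linarith
  have h2 : sq2 (b - a) ≤ 2 * n * ‖a - b‖ ^ 2 := by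
    rw [norm_sub_rev]
    have e1 := sq_le (b - a).1
    have e2 := sq_le (b - a).2
    have f1 : ‖(b - a).1‖ ^ 2 ≤ ‖b - a‖ ^ 2 := pow_le_pow_left₀ (norm_nonneg _) (norm_fst_le _) 2
    have f2 : ‖(b - a).2‖ ^ 2 ≤ ‖b - a‖ ^ 2 := pow_le_pow_left₀ (norm_nonneg _) (norm_snd_le _) 2
    have hn : (0:ℝ) ≤ n := by positivity
    unfold sq2
    nlinarith
  have hq := sq2_nonneg a
  set d := ‖a - b‖ with hd
  have hd0 : 0 ≤ d := norm_nonneg _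
  have hn : (0:ℝ) ≤ n := by positivity
  have h3 : (2 + 4 * n) * (1 + d ^ 2) * (1 + sq2 a) ≤ (2 + 4 * n) * (1 + d) ^ 2 * (1 + sq2 a) := by
    gcongr
    nlinarith
  refine le_trans ?_ h3
  have : (2 + 4 * n) * (1 + d ^ 2) * (1 + sq2 a) - (1 + (2 * sq2 a + 2 * (2 * n * d ^ 2))) =
    1 + 2 * d ^ 2 + 2 * d ^ 2 * sq2 a + 4 * n + 4 * n * sq2 a + 4 * n * d ^ 2 * sq2 a := by ring
  have : 0 ≤ 1 + 2 * d ^ 2 + 2 * d ^ 2 * sq2 a + 4 * n + 4 * n * sq2 a + 4 * n * d ^ 2 * sq2 a := by positivity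
  linarith

/-- The weight. -/
lemma weight_shift (s : ℝ) (hs : 0 ≤ s) (a b : Ph n) :
    (1 + sq2 a) ^ (-(s / 2)) ≤ (2 + 4 * n : ℝ) ^ (s / 2) * (1 + ‖a - b‖) ^ ⌈s⌉₊ * (1 + sq2 b) ^ (-(s / 2)) := by
  have ha := sq2_nonneg a
  have hb := sq2_nonneg b
  have h := Real.rpow_le_rpow (by positivity) (sq2_shift a b) (by positivity : 0 ≤ s / 2)
  rw [Real.mul_rpow (by positivity) (by positivity), Real.mul_rpow (by positivity) (by positivity)] at h
  have h1 : ((1 + ‖a - b‖) ^ 2) ^ (s / 2) ≤ (1 + ‖a - b‖) ^ ⌈s⌉₊ := by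
    rw [← Real.rpow_natCast, ← Real.rpow_natCast, ← Real.rpow_mul (by positivity)]
    refine Real.rpow_le_rpow_of_exponent_le (by linarith [norm_nonneg (a - b)]) ?_
    have := Nat.le_ceil s
    push_cast; linarith
  rw [Real.rpow_neg (by positivity), Real.rpow_neg (by positivity)]
  have pa : 0 < (1 + sq2 a) ^ (s / 2) := by positivity
  have pb : 0 < (1 + sq2 b) ^ (s / 2) := by positivity
  rw [← div_eq_mul_inv, le_div_iff₀ pb, ← div_eq_inv_mul, div_le_iff₀ pa]
  refine h.trans ?_
  gcongr

lemma sum_step (α β : ℝ) (K : ℝ)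
    (hK : ∀ u : Ph n, Summable (fun k => ((1 + ‖latt α β k - u‖) ^ (4 * n))⁻¹) ∧
      ∑' k, ((1 + ‖latt α β k - u‖) ^ (4 * n))⁻¹ ≤ K)
    (N : ℕ) (a D : ℝ) (ha : 0 ≤ a) (hD : 0 ≤ D) (u : Ph n) (c x : (Fin n → ℤ) × (Fin n → ℤ) → ℂ) (X : ℂ)
    (hX : HasSum (fun k => c k * x k) X)
    (hc : ∀ k, ‖c k‖ ≤ a * ((1 + ‖latt α β k - u‖) ^ (4 * n + N))⁻¹)
    (hx : ∀ k, ‖x k‖ ≤ D * (1 + ‖latt α β k - u‖) ^ N) : ‖X‖ ≤ a * D * K := by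
  have h1 := ((hK u).1.mul_left (a * D)).hasSum
  rw [tsum_mul_left] at h1
  refine (hX.norm_le_of_bounded h1 fun k => ?_).trans ?_
  · rw [norm_mul]
    refine (mul_le_mul (hc k) (hx k) (norm_nonneg _) (by positivity)).trans (le_of_eq ?_)
    have : (1 + ‖latt α β k - u‖) ≠ 0 := by positivity
    rw [pow_add]
    field_simp
  · have := (hK u).2
    gcongr

lemma chi_lip (χ : Ph n → Ph n) (hχ : IsTameSymplecto χ) : ∃ L, 0 ≤ L ∧ ∀ (r : ℝ), 0 < r → ∀ z w : Ph n,
    ‖r⁻¹ • χ (r • z) - r⁻¹ • χ (r • w)‖ ≤ L * ‖z - w‖ := by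
  obtain ⟨C, hC⟩ := hχ.2.2.2 1 le_rfl
  refine ⟨C, (norm_nonneg _).trans (hC 0), fun r hr z w => ?_⟩
  have hd : Differentiable ℝ χ := hχ.1.differentiable (by simp)
  have h := Convex.norm_image_sub_le_of_norm_fderiv_le (𝕜 := ℝ) (f := χ) (s := Set.univ) (C := C)
    (fun x _ => hd x) (fun x _ => by rw [← norm_iteratedFDeriv_one]; exact hC x) convex_univ
    (Set.mem_univ (r • w)) (Set.mem_univ (r • z))
  rw [← smul_sub, norm_smul, Real.norm_of_nonneg (by positivity)]
  rw [← smul_sub, norm_smul, Real.norm_of_nonneg hr.le] at h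
  calc r⁻¹ * ‖χ (r • z) - χ (r • w)‖ ≤ r⁻¹ * (C * (r * ‖z - w‖)) := by gcongr
    _ = C * ‖z - w‖ := by field_simp

end final

theorem stmt9 (n : ℕ) (χ : Ph n → Ph n) (hχ : IsTameSymplecto χ)
    (g : SchwartzMap (Rn n) ℂ) (s : ℝ) (hs : 0 ≤ s)
    (α β : ℝ) (hα : 0 < α) (hβ : 0 < β)
    (hframe : IsFrame (fun k => T1 (latt α β k) ⇑g))
    (A : ℝ → (SchwartzMap (Rn n) ℂ →L[ℂ] Distrib n)) :
    (∃ C : ℝ, 0 < C ∧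
      ∀ hbar : ℝ, 0 < hbar → hbar ≤ 1 →
      ∀ z w : Ph n, ∀ Φ Ψ : SchwartzMap (Rn n) ℂ,
      (∀ t, Φ t = WH hbar z (gh (2 * Real.pi * hbar) ⇑g) t) →
      (∀ t, Ψ t = conj (WH hbar w (gh (2 * Real.pi * hbar) ⇑g) t)) →
      ‖A hbar Φ Ψ‖ ≤
        C * (1 + sq2 ((Real.sqrt (2 * Real.pi * hbar))⁻¹ • (w - χ z))) ^ (-(s / 2))) ↔
    (∃ C' : ℝ, 0 < C' ∧
      ∀ hbar : ℝ, 0 < hbar → hbar ≤ 1 →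
      ∀ k k' : (Fin n → ℤ) × (Fin n → ℤ), ∀ Φ Ψ : SchwartzMap (Rn n) ℂ,
      (∀ t, Φ t = WH hbar (Real.sqrt (2 * Real.pi * hbar) • latt α β k)
        (gh (2 * Real.pi * hbar) ⇑g) t) →
      (∀ t, Ψ t = conj (WH hbar (Real.sqrt (2 * Real.pi * hbar) • latt α β k')
        (gh (2 * Real.pi * hbar) ⇑g) t)) →
      ‖A hbar Φ Ψ‖ ≤
        C' * (1 + sq2 ((Real.sqrt (2 * Real.pi * hbar))⁻¹ •
          (Real.sqrt (2 * Real.pi * hbar) • latt α β k' -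
            χ (Real.sqrt (2 * Real.pi * hbar) • latt α β k)))) ^ (-(s / 2))) := by
  constructor
  · rintro ⟨C, hC, h⟩
    exact ⟨C, hC, fun hbar h0 h1 k k' Φ Ψ hΦ hΨ => h hbar h0 h1 _ _ Φ Ψ hΦ hΨ⟩
  rintro ⟨C', hC', h⟩
  obtain ⟨K, hK0, hK⟩ := lattice_sum (n := n) α β hα hβ
  obtain ⟨c, hc, hcs⟩ := gabor_expand g α β hα hβ hframe
  obtain ⟨L, hL0, hL⟩ := chi_lip χ hχ
  set N := ⌈s⌉₊ with hN
  obtain ⟨a, ha0, ha⟩ := hc (4 * n + N)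
  set Q : ℝ := (2 + 4 * n : ℝ) ^ (s / 2) with hQ
  have hQ0 : 0 < Q := by positivity
  set D1 : ℝ := C' * Q * (1 + L) ^ N with hD1
  set D2 : ℝ := a * D1 * K * Q with hD2
  have hD10 : 0 ≤ D1 := by positivity
  have hD20 : 0 ≤ D2 := by positivity
  refine ⟨a * D2 * K + 1, by positivity, fun hbar h0 h1 z w Φ Ψ hΦ hΨ => ?_⟩
  have hpos : 0 < 2 * Real.pi * hbar := by positivity
  set r := Real.sqrt (2 * Real.pi * hbar) with hr
  have hr0 : 0 < r := Real.sqrt_pos.2 hpos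
  have hrr : r ^ 2 = 2 * Real.pi * hbar := Real.sq_sqrt hpos.le
  set z' := r⁻¹ • z with hz'
  set w' := r⁻¹ • w with hw'
  have ez : r • z' = z := by rw [hz', smul_smul, mul_inv_cancel₀ hr0.ne', one_smul]
  have ew : r • w' = w := by rw [hw', smul_smul, mul_inv_cancel₀ hr0.ne', one_smul]
  have hDS := fun u t => DS_TF hbar r h0 hr0 hrr u g t
  have eΦ : Φ = DS r hr0.ne' (TF z' g) := by
    ext t; rw [hΦ, hDS, ez]; rfl
  have eΨ : Ψ = conjS (DS r hr0.ne' (TF w' g)) := by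
    ext t; rw [hΨ, conjS_apply, hDS, ew]; rfl
  -- the discrete estimate
  have hdisc : ∀ k k', ‖A hbar (DS r hr0.ne' (TF (latt α β k) g)) (conjS (DS r hr0.ne' (TF (latt α β k') g)))‖ ≤
      C' * (1 + sq2 (latt α β k' - r⁻¹ • χ (r • latt α β k))) ^ (-(s / 2)) := by
    intro k k'
    have := h hbar h0 h1 k k' (DS r hr0.ne' (TF (latt α β k) g)) (conjS (DS r hr0.ne' (TF (latt α β k') g)))
      (fun t => hDS _ t) (fun t => by rw [conjS_apply, hDS]; rfl)
    rwa [smul_sub, smul_smul, inv_mul_cancel₀ hr0.ne', one_smul] at this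
  set y := r⁻¹ • χ (r • z') with hy
  -- expansion in the first slot
  have step1 : ∀ k', ‖A hbar Φ (conjS (DS r hr0.ne' (TF (latt α β k') g)))‖ ≤
      a * (D1 * (1 + sq2 (latt α β k' - y)) ^ (-(s / 2))) * K := by
    intro k'
    set Ψ' := conjS (DS r hr0.ne' (TF (latt α β k') g)) with hΨ'
    have hW := sq2_nonneg (latt α β k' - y)
    have hsum : HasSum (fun k => c z' k * A hbar (DS r hr0.ne' (TF (latt α β k) g)) Ψ') (A hbar Φ Ψ') := by
      have q1 := (DS r hr0.ne').hasSum (hcs z')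
      have q2 := (A hbar).hasSum q1
      have q3 := q2.map (AddMonoidHom.mk' (fun T : Distrib n => T Ψ') (fun _ _ => rfl)) (continuous_eval_const Ψ')
      rw [eΦ]
      refine (congrArg (fun F => HasSum F _) ?_).mpr q3
      funext k
      simp
    refine sum_step α β K hK N a _ ha0 (by positivity) z' _ _ _ hsum (ha z') fun k => ?_
    refine (hdisc k k').trans ?_
    have q4 := weight_shift s hs (latt α β k' - r⁻¹ • χ (r • latt α β k)) (latt α β k' - y)
    have q5 : 1 + ‖(latt α β k' - r⁻¹ • χ (r • latt α β k)) - (latt α β k' - y)‖ ≤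
        (1 + L) * (1 + ‖latt α β k - z'‖) := by
      rw [sub_sub_sub_cancel_left, norm_sub_rev]
      have := hL r hr0 (latt α β k) z'
      nlinarith [norm_nonneg (latt α β k - z')]
    calc C' * (1 + sq2 (latt α β k' - r⁻¹ • χ (r • latt α β k))) ^ (-(s / 2))
        ≤ C' * (Q * ((1 + L) * (1 + ‖latt α β k - z'‖)) ^ N * (1 + sq2 (latt α β k' - y)) ^ (-(s / 2))) := by
          refine mul_le_mul_of_nonneg_left (q4.trans ?_) hC'.le
          rw [← hN]
          gcongr
      _ = D1 * (1 + sq2 (latt α β k' - y)) ^ (-(s / 2)) * (1 + ‖latt α β k - z'‖) ^ N := by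
          rw [hD1, mul_pow]; ring
  -- expansion in the second slot
  have hW := sq2_nonneg (w' - y)
  have hsum2 : HasSum (fun k => conj (c w' k) * A hbar Φ (conjS (DS r hr0.ne' (TF (latt α β k) g)))) (A hbar Φ Ψ) := by
    have q1 := (DS r hr0.ne').hasSum (hcs w')
    have q2 := conjS.hasSum q1
    have q3 := (A hbar Φ).hasSum q2
    rw [eΨ]
    refine (congrArg (fun F => HasSum F _) ?_).mpr q3
    funext k
    have : conjS (DS r hr0.ne' (c w' k • TF (latt α β k) g)) =
        conj (c w' k) • conjS (DS r hr0.ne' (TF (latt α β k) g)) := by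
      ext t
      rw [map_smul, conjS_apply, smul_apply, smul_apply, conjS_apply]
      simp
    rw [this, map_smul, smul_eq_mul]
  have fin := sum_step α β K hK N a (D2 * (1 + sq2 (w' - y)) ^ (-(s / 2))) ha0 (by positivity) w'
    _ _ _ hsum2 (fun k => by rw [RCLike.norm_conj]; exact ha w' k) (fun k => by
      refine (step1 k).trans ?_
      have q4 := weight_shift s hs (latt α β k - y) (w' - y)
      rw [sub_sub_sub_cancel_right, ← hN] at q4
      calc a * (D1 * (1 + sq2 (latt α β k - y)) ^ (-(s / 2))) * K
          ≤ a * (D1 * (Q * (1 + ‖latt α β k - w'‖) ^ N * (1 + sq2 (w' - y)) ^ (-(s / 2)))) * K := by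
            gcongr
        _ = D2 * (1 + sq2 (w' - y)) ^ (-(s / 2)) * (1 + ‖latt α β k - w'‖) ^ N := by
            rw [hD2]; ring)
  have e3 : r⁻¹ • (w - χ z) = w' - y := by rw [smul_sub, hy, ez]
  rw [e3]
  refine fin.trans ?_
  have : 0 ≤ (1 + sq2 (w' - y)) ^ (-(s / 2)) := by positivity
  nlinarith

end SC
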